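/- arXiv:2302.01377 — 2 statements merged into one kernel-verified Lean document; each statement's English description precedes it below -/
import Mathlib

section
/- There is a universal constant C such that the following holds for every τ ≥ 2. Suppose there exists γ ∈ (0,1/k] with Σ_{a∈K} max(δ_a, γ·τ) ≤ τ. Then there exists a subset Z* ⊆ K (a maximizer of DOAlg(c^+,·)) and a phase-independent algorithm LCB* committed to Z* such that E[r^{LCB*}] ≥ E[r^{PICO}] − C·n·T·√(log τ)/√τ. -/
open scoped BigOperators Classical

namespace ExposureBandits

/-- Number of pulls of arm `a` in the (0-indexed) phase `j` of the pull sequence `pull`. -/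
def pullsInPhase {k : ℕ} (T τ : ℕ) (pull : Fin T → Fin k) (j : ℕ) (a : Fin k) : ℕ :=
  (Finset.univ.filter (fun t : Fin T =>
    j * τ ≤ (t : ℕ) ∧ (t : ℕ) < (j + 1) * τ ∧ pull t = a)).card

/-- Arm `a` is available at round `t` iff its exposure constraint was satisfied in every
completed phase. -/
def availableAt {k : ℕ} (T τ : ℕ) (δ : Fin k → ℕ) (pull : Fin T → Fin k)
    (t : Fin T) (a : Fin k) : Prop :=
  ∀ j : ℕ, (j + 1) * τ ≤ (t : ℕ) → δ a ≤ pullsInPhase T τ pull j a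

/-- Conditional-expected reward of the pull sequence `pull` on the arrival sequence `q`:
pulls of unavailable (departed) arms yield zero utility. -/
noncomputable def seqReward {k n : ℕ} (T τ : ℕ) (μ : Fin n → Fin k → ℝ) (δ : Fin k → ℕ)
    (pull : Fin T → Fin k) (q : Fin T → Fin n) : ℝ :=
  ∑ t : Fin T, if availableAt T τ δ pull t (pull t) then μ (q t) (pull t) else 0

/-- A deterministic online algorithm for the stochastic-optimization task: the arm pulled at
round `t` may depend only on the types observed in rounds `1,…,t`. -/
def Causal {k n T : ℕ} (f : (Fin T → Fin n) → Fin T → Fin k) : Prop :=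
  ∀ q q' : Fin T → Fin n, ∀ t : Fin T,
    (∀ s : Fin T, s ≤ t → q s = q' s) → f q t = f q' t

abbrev Alg (k n T : ℕ) := {f : (Fin T → Fin n) → Fin T → Fin k // Causal f}

/-- Probability of the i.i.d. arrival sequence `q` under the arrival distribution `P`. -/
noncomputable def seqProb {n : ℕ} (T : ℕ) (P : Fin n → ℝ) (q : Fin T → Fin n) : ℝ :=
  ∏ t : Fin T, P (q t)

/-- Expected reward of the algorithm `A`. -/
noncomputable def expReward {k n : ℕ} (T τ : ℕ) (P : Fin n → ℝ) (μ : Fin n → Fin k → ℝ)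
    (δ : Fin k → ℕ) (A : Alg k n T) : ℝ :=
  ∑ q : Fin T → Fin n, seqProb T P q * seqReward T τ μ δ (A.1 q) q

/-- The optimal expected reward: the value of the benchmark `OPT`. -/
noncomputable def optReward (k n T τ : ℕ) (P : Fin n → ℝ) (μ : Fin n → Fin k → ℝ)
    (δ : Fin k → ℕ) : ℝ :=
  ⨆ A : Alg k n T, expReward T τ P μ δ A

/-- Property 1 (phase independence): whenever the type prefixes of two phases agree, the
algorithm's pulls at the corresponding rounds agree. -/
def PhaseInd {k n T : ℕ} (τ : ℕ) (A : Alg k n T) : Prop :=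
  ∀ q : Fin T → Fin n, ∀ i j s : ℕ, s < τ →
    ∀ (hi : i * τ + s < T) (hj : j * τ + s < T),
      (∀ l : ℕ, l ≤ s → ∀ (hli : i * τ + l < T) (hlj : j * τ + l < T),
          q ⟨i * τ + l, hli⟩ = q ⟨j * τ + l, hlj⟩) →
      A.1 q ⟨i * τ + s, hi⟩ = A.1 q ⟨j * τ + s, hj⟩

/-- Property 2 (commitment to `Z`): the algorithm pulls only arms of `Z` and, with
probability 1, every arm of `Z` receives at least its exposure threshold in every phase. -/
def Committed {k n T : ℕ} (τ : ℕ) (δ : Fin k → ℕ) (Z : Finset (Fin k)) (A : Alg k n T) : Prop :=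
  ∀ q : Fin T → Fin n,
    (∀ t : Fin T, A.1 q t ∈ Z) ∧
    (∀ j : ℕ, (j + 1) * τ ≤ T → ∀ a ∈ Z, δ a ≤ pullsInPhase T τ (A.1 q) j a)

/-- The value of `PICO`: the best expected reward among phase-independent algorithms committed
to some subset of the arms. -/
noncomputable def picoReward (k n T τ : ℕ) (P : Fin n → ℝ) (μ : Fin n → Fin k → ℝ)
    (δ : Fin k → ℕ) : ℝ :=
  ⨆ A : {A : Alg k n T // PhaseInd τ A ∧ ∃ Z : Finset (Fin k), Committed τ δ Z A},
    expReward T τ P μ δ A.1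

/-- `DOAlg(c, Z)`: the maximum reward of a matching of the users given by the aggregate `c`
to the arms of `Z`, satisfying the exposure constraints of every arm of `Z`. -/
noncomputable def DOAlgR {k m : ℕ} (μ : Fin m → Fin k → ℝ) (δ : Fin k → ℕ)
    (c : Fin m → ℕ) (Z : Finset (Fin k)) : ℝ :=
  sSup {r : ℝ | ∃ M : Fin m → Fin k → ℕ,
    (∀ u, ∑ a, M u a = c u) ∧ (∀ u a, a ∉ Z → M u a = 0) ∧
    (∀ a ∈ Z, δ a ≤ ∑ u, M u a) ∧
    r = ∑ u, ∑ a, (M u a : ℝ) * μ u a}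

/-- The utility matrix augmented with the slack user type `u⋆` (the last index), whose utility
is `0` for every arm. -/
noncomputable def muPlus {k n : ℕ} (μ : Fin n → Fin k → ℝ) : Fin (n + 1) → Fin k → ℝ :=
  Fin.snoc μ (fun _ => 0)

/-- `c⁺_u = ⌊P_u·τ − √(τ·log τ)⌋` for a real user type `u`. -/
noncomputable def cplusBase {n : ℕ} (P : Fin n → ℝ) (τ : ℕ) (u : Fin n) : ℕ :=
  ⌊P u * τ - Real.sqrt (τ * Real.log τ)⌋₊

/-- The augmented lower-confidence aggregate `c⁺`: its last entry is the number of slack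
users, absorbing the gap between the lower confidence bounds and the phase length. -/
noncomputable def cplus {n : ℕ} (P : Fin n → ℝ) (τ : ℕ) : Fin (n + 1) → ℕ :=
  Fin.snoc (cplusBase P τ) (τ - ∑ u, cplusBase P τ u)


/-! ### Phase bookkeeping -/

theorem idx_lt {N τ j s : ℕ} (hj : j < N) (hs : s < τ) : j * τ + s < N * τ := by
  have : (j + 1) * τ ≤ N * τ := Nat.mul_le_mul_right _ hj
  have h2 : (j + 1) * τ = j * τ + τ := by ring
  omega

theorem bridge_phase {M : Type*} [AddCommMonoid M] {N τ : ℕ} (F : Fin (N * τ) → M) (G : ℕ → M)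
    {j : ℕ} (hj : j < N)
    (h : ∀ s, s < τ → ∀ hh : j * τ + s < N * τ, F ⟨j * τ + s, hh⟩ = G s) :
    ∑ t ∈ Finset.univ.filter (fun t : Fin (N * τ) => j * τ ≤ (t : ℕ) ∧ (t : ℕ) < (j + 1) * τ), F t
      = ∑ s ∈ Finset.range τ, G s := by
  have e : (j + 1) * τ = j * τ + τ := by ring
  symm
  refine Finset.sum_bij (fun s hs => (⟨j * τ + s, idx_lt hj (Finset.mem_range.1 hs)⟩ : Fin (N * τ)))
    ?_ ?_ ?_ ?_
  · intro s hs
    have := Finset.mem_range.1 hs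
    simp only [Finset.mem_filter, Finset.mem_univ, true_and]
    omega
  · intro a ha b hb hab
    simp only [Fin.mk.injEq] at hab
    omega
  · intro b hb
    simp only [Finset.mem_filter, Finset.mem_univ, true_and] at hb
    refine ⟨b - j * τ, Finset.mem_range.2 (by omega), ?_⟩
    apply Fin.ext
    simp only
    omega
  · intro s hs
    exact (h s (Finset.mem_range.1 hs) _).symm

theorem bridge_all {M : Type*} [AddCommMonoid M] {N τ : ℕ} (hτ : 0 < τ) (F : Fin (N * τ) → M)
    (G : ℕ → ℕ → M)
    (h : ∀ j, j < N → ∀ s, s < τ → ∀ hh : j * τ + s < N * τ, F ⟨j * τ + s, hh⟩ = G j s) :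
    ∑ t, F t = ∑ j ∈ Finset.range N, ∑ s ∈ Finset.range τ, G j s := by
  rw [← Finset.sum_fiberwise_of_maps_to (s := Finset.univ) (t := Finset.range N)
    (g := fun t : Fin (N * τ) => (t : ℕ) / τ)]
  · refine Finset.sum_congr rfl fun j hj => ?_
    have hj := Finset.mem_range.1 hj
    rw [← bridge_phase F (G j) hj (h j hj)]
    refine Finset.sum_congr ?_ fun _ _ => rfl
    ext t
    simp only [Finset.mem_filter, Finset.mem_univ, true_and]
    rw [Nat.div_eq_iff hτ, add_mul]
    constructor
    · rintro ⟨a, b⟩; constructor <;> omega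
    · rintro ⟨a, b⟩; constructor <;> omega
  · intro t _
    exact Finset.mem_range.2 ((Nat.div_lt_iff_lt_mul hτ).2 t.2)

/-! ### Relabelling -/

theorem sum_count {α : Type*} [Fintype α] [DecidableEq α] (w : ℕ → α) (T : ℕ) :
    ∑ a, Nat.count (fun s => w s = a) T = T := by
  induction T with
  | zero => simp
  | succ T ih => simp [Nat.count_succ, Finset.sum_add_distrib, ih]

theorem count_update {α : Type*} [DecidableEq α] (w : ℕ → α) (T t : ℕ) (ht : t < T) (b x : α) :
    Nat.count (fun s => Function.update w t b s = x) T + (if w t = x then 1 else 0)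
      = Nat.count (fun s => w s = x) T + (if b = x then 1 else 0) := by
  induction T with
  | zero => omega
  | succ T ih =>
    rw [Nat.count_succ, Nat.count_succ]
    rcases Nat.lt_succ_iff_lt_or_eq.1 ht with h | h
    · have := ih h
      have h2 : T ≠ t := by omega
      simp only [Function.update_of_ne h2]
      omega
    · subst h
      have : Nat.count (fun s => Function.update w t b s = x) t = Nat.count (fun s => w s = x) t := by
        rw [Nat.count_eq_card_filter_range, Nat.count_eq_card_filter_range]
        congr 1
        apply Finset.filter_congr
        intro s hs
        have : s ≠ t := by have := Finset.mem_range.1 hs; omega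
        simp [Function.update_of_ne this]
      simp only [Function.update_self]
      omega

theorem retype_seq {α : Type*} [Fintype α] [DecidableEq α] (T : ℕ) (c : α → ℕ) (hc : ∑ a, c a = T) :
    ∀ (d : ℕ) (w : ℕ → α), ∑ a, (Nat.count (fun s => w s = a) T - c a) = d →
      ∃ v : ℕ → α, (∀ a, Nat.count (fun s => v s = a) T = c a) ∧
        ((Finset.range T).filter (fun s => v s ≠ w s)).card ≤ d := by
  intro d
  induction d with
  | zero =>
    intro w hw
    refine ⟨w, ?_, by simp⟩
    have h1 : ∀ a ∈ Finset.univ, Nat.count (fun s => w s = a) T ≤ c a := by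
      intro a ha
      have := (Finset.sum_eq_zero_iff.1 hw) a ha
      omega
    have := (Finset.sum_eq_sum_iff_of_le h1).1 (by rw [sum_count, hc])
    exact fun a => this a (Finset.mem_univ _)
  | succ d ih =>
    intro w hw
    have hex : ∃ a, c a < Nat.count (fun s => w s = a) T := by
      by_contra! hcon
      have : ∑ a, (Nat.count (fun s => w s = a) T - c a) = 0 :=
        Finset.sum_eq_zero fun a _ => by have := hcon a; omega
      omega
    obtain ⟨a, ha⟩ := hex
    have hex2 : ∃ b, Nat.count (fun s => w s = b) T < c b := by
      by_contra! hcon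
      have : ∑ a, c a < ∑ a, Nat.count (fun s => w s = a) T :=
        Finset.sum_lt_sum (fun i _ => hcon i) ⟨a, Finset.mem_univ _, ha⟩
      rw [sum_count, hc] at this
      omega
    obtain ⟨b, hb⟩ := hex2
    have hab : b ≠ a := by rintro rfl; omega
    have hex3 : ∃ t, t < T ∧ w t = a := by
      by_contra! hcon
      have : Nat.count (fun s => w s = a) T = 0 := by
        rw [Nat.count_eq_card_filter_range, Finset.card_eq_zero, Finset.filter_eq_empty_iff]
        intro s hs
        exact hcon s (Finset.mem_range.1 hs)
      omega
    obtain ⟨t, ht, hta⟩ := hex3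
    have hcu := count_update w T t ht b
    have key : ∑ x, (Nat.count (fun s => Function.update w t b s = x) T - c x) = d := by
      have : ∀ x, (Nat.count (fun s => w s = x) T - c x) =
          (Nat.count (fun s => Function.update w t b s = x) T - c x) + (if x = a then 1 else 0) := by
        intro x
        have h := hcu x
        by_cases h1 : x = a
        · subst h1
          simp only [hta, if_true, hab, if_false] at h ⊢
          omega
        · by_cases h2 : x = b
          · subst h2
            rw [if_neg (by rw [hta]; exact fun h => h1 h.symm), if_pos rfl] at h
            simp only [h1, if_false]
            omega
          · rw [if_neg (by rw [hta]; exact fun h => h1 h.symm), if_neg (fun h => h2 h.symm)] at h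
            simp only [h1, if_false]
            omega
      rw [Finset.sum_congr rfl fun x _ => this x, Finset.sum_add_distrib] at hw
      simp at hw
      omega
    obtain ⟨v, hv, hcard⟩ := ih _ key
    refine ⟨v, hv, ?_⟩
    have hsub : (Finset.range T).filter (fun s => v s ≠ w s) ⊆
        insert t ((Finset.range T).filter (fun s => v s ≠ Function.update w t b s)) := by
      intro s hs
      simp only [Finset.mem_filter, Finset.mem_insert] at hs ⊢
      by_cases h : s = t
      · exact Or.inl h
      · right
        rw [Function.update_of_ne h]
        exact hs
    calc _ ≤ _ := Finset.card_le_card hsub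
      _ ≤ _ := Finset.card_insert_le _ _
      _ ≤ d + 1 := by omega

theorem sum_occ {α M : Type*} [DecidableEq α] [AddCommMonoid M] (v : ℕ → α) (u : α) (h : ℕ → M)
    (T : ℕ) :
    ∑ t ∈ Finset.range T, (if v t = u then h (Nat.count (fun s => v s = u) t) else 0)
      = ∑ i ∈ Finset.range (Nat.count (fun s => v s = u) T), h i := by
  induction T with
  | zero => simp
  | succ T ih =>
    rw [Finset.sum_range_succ, ih, Nat.count_succ]
    split_ifs with h1
    · rw [Finset.sum_range_succ]
    · simp

theorem matrix_value {m k : ℕ} (v : ℕ → Fin m) (p : ℕ → Fin k) (f : Fin m → Fin k → ℝ) (T : ℕ) :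
    ∑ u, ∑ a, (Nat.count (fun s => v s = u ∧ p s = a) T : ℝ) * f u a
      = ∑ t ∈ Finset.range T, f (v t) (p t) := by
  induction T with
  | zero => simp
  | succ T ih =>
    rw [Finset.sum_range_succ, ← ih]
    simp only [Nat.count_succ, Nat.cast_add, add_mul, Finset.sum_add_distrib]
    congr 1
    rw [Finset.sum_eq_single (v T), Finset.sum_eq_single (p T)]
    · simp
    · intro a _ ha; simp [ha.symm]
    · simp
    · intro u _ hu
      apply Finset.sum_eq_zero
      intro a _
      simp [hu.symm]
    · simp

theorem sum_count_left {m k : ℕ} (v : ℕ → Fin m) (p : ℕ → Fin k) (T : ℕ) (a : Fin k) :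
    ∑ u, Nat.count (fun s => v s = u ∧ p s = a) T = Nat.count (fun s => p s = a) T := by
  induction T with
  | zero => simp
  | succ T ih =>
    simp only [Nat.count_succ, Finset.sum_add_distrib, ih]
    congr 1
    rw [Finset.sum_eq_single (v T)]
    · simp
    · intro u _ hu; simp [hu.symm]
    · simp

theorem sum_count_right {m k : ℕ} (v : ℕ → Fin m) (p : ℕ → Fin k) (T : ℕ) (u : Fin m) :
    ∑ a, Nat.count (fun s => v s = u ∧ p s = a) T = Nat.count (fun s => v s = u) T := by
  induction T with
  | zero => simp
  | succ T ih =>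
    simp only [Nat.count_succ, Finset.sum_add_distrib, ih]
    congr 1
    rw [Finset.sum_eq_single (p T)]
    · simp
    · intro u _ hu; simp [hu.symm]
    · simp

/-! ### The corrected online rule -/

noncomputable def stepArm {k : ℕ} (τ : ℕ) (δ : Fin k → ℕ) (Z : Finset (Fin k)) (p : Fin k) (s : ℕ)
    (c : Fin k → ℕ) : Fin k :=
  if ∑ a ∈ Z, (δ a - (c a + if p = a then 1 else 0)) ≤ τ - (s + 1) then p
  else if h : ∃ a ∈ Z, c a < δ a then h.choose else p

noncomputable def stateArm {k : ℕ} (τ : ℕ) (δ : Fin k → ℕ) (Z : Finset (Fin k)) (π : ℕ → Fin k) :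
    ℕ → Fin k → ℕ
  | 0 => fun _ => 0
  | s + 1 => fun a => stateArm τ δ Z π s a +
      if stepArm τ δ Z (π s) s (stateArm τ δ Z π s) = a then 1 else 0

noncomputable def corr {k : ℕ} (τ : ℕ) (δ : Fin k → ℕ) (Z : Finset (Fin k)) (π : ℕ → Fin k)
    (s : ℕ) : Fin k :=
  stepArm τ δ Z (π s) s (stateArm τ δ Z π s)

theorem stateArm_eq {k : ℕ} (τ : ℕ) (δ : Fin k → ℕ) (Z : Finset (Fin k)) (π : ℕ → Fin k) (s : ℕ)
    (a : Fin k) : stateArm τ δ Z π s a = Nat.count (fun t => corr τ δ Z π t = a) s := by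
  induction s with
  | zero => simp [stateArm]
  | succ s ih => rw [Nat.count_succ, ← ih]; rfl

theorem stateArm_congr {k : ℕ} (τ : ℕ) (δ : Fin k → ℕ) (Z : Finset (Fin k)) (π π' : ℕ → Fin k)
    (s : ℕ) (h : ∀ l, l < s → π l = π' l) : stateArm τ δ Z π s = stateArm τ δ Z π' s := by
  induction s with
  | zero => rfl
  | succ s ih =>
    have h1 := ih fun l hl => h l (by omega)
    funext a
    simp only [stateArm, h1, h s (by omega)]

theorem corr_congr {k : ℕ} (τ : ℕ) (δ : Fin k → ℕ) (Z : Finset (Fin k)) (π π' : ℕ → Fin k)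
    (s : ℕ) (h : ∀ l, l ≤ s → π l = π' l) : corr τ δ Z π s = corr τ δ Z π' s := by
  unfold corr
  rw [stateArm_congr τ δ Z π π' s fun l hl => h l hl.le, h s le_rfl]

theorem corr_mem {k : ℕ} (τ : ℕ) (δ : Fin k → ℕ) (Z : Finset (Fin k)) (π : ℕ → Fin k)
    (s : ℕ) (h : π s ∈ Z) : corr τ δ Z π s ∈ Z := by
  unfold corr stepArm
  split_ifs with h1 h2
  · exact h
  · exact h2.choose_spec.1
  · exact h

theorem corr_need {k : ℕ} (τ : ℕ) (δ : Fin k → ℕ) (Z : Finset (Fin k)) (π : ℕ → Fin k)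
    (hZ : ∑ a ∈ Z, δ a ≤ τ) (s : ℕ) (hs : s ≤ τ) :
    ∑ a ∈ Z, (δ a - stateArm τ δ Z π s a) ≤ τ - s := by
  induction s with
  | zero => simpa [stateArm] using hZ
  | succ s ih =>
    have ih := ih (by omega)
    simp only [stateArm]
    set c := stateArm τ δ Z π s with hc
    by_cases h1 : ∑ a ∈ Z, (δ a - (c a + if π s = a then 1 else 0)) ≤ τ - (s + 1)
    · have : stepArm τ δ Z (π s) s c = π s := by unfold stepArm; rw [if_pos h1]
      rw [this]; exact h1
    · by_cases h2 : ∃ a ∈ Z, c a < δ a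
      · have e : stepArm τ δ Z (π s) s c = h2.choose := by
          unfold stepArm; rw [if_neg h1, dif_pos h2]
        obtain ⟨hm, hl⟩ := h2.choose_spec
        rw [e]
        have : ∑ a ∈ Z, (δ a - (c a + if h2.choose = a then 1 else 0)) < ∑ a ∈ Z, (δ a - c a) := by
          refine Finset.sum_lt_sum (fun a _ => by omega) ⟨_, hm, ?_⟩
          rw [if_pos rfl]
          omega
        omega
      · exfalso
        apply h1
        have : ∑ a ∈ Z, (δ a - (c a + if π s = a then 1 else 0)) = 0 := by
          push Not at h2
          exact Finset.sum_eq_zero fun a ha => by have := h2 a ha; omega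
        omega

theorem corr_feasible {k : ℕ} (τ : ℕ) (δ : Fin k → ℕ) (Z : Finset (Fin k)) (π : ℕ → Fin k)
    (hZ : ∑ a ∈ Z, δ a ≤ τ) (a : Fin k) (ha : a ∈ Z) :
    δ a ≤ Nat.count (fun t => corr τ δ Z π t = a) τ := by
  have := corr_need τ δ Z π hZ τ le_rfl
  have h0 : ∑ a ∈ Z, (δ a - stateArm τ δ Z π τ a) = 0 := by omega
  have := (Finset.sum_eq_zero_iff.1 h0) a ha
  rw [stateArm_eq] at this
  omega

theorem corr_eq {k : ℕ} (τ : ℕ) (δ : Fin k → ℕ) (Z : Finset (Fin k)) (π : ℕ → Fin k)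
    (hπ : ∀ a ∈ Z, δ a ≤ Nat.count (fun t => π t = a) τ) (s : ℕ) (hs : s < τ) :
    corr τ δ Z π s = π s := by
  have hneed : ∀ s, s ≤ τ → ∑ a ∈ Z, (δ a - Nat.count (fun t => π t = a) s) ≤ τ - s := by
    intro s hs
    have h1 : ∑ a ∈ Z, (δ a - Nat.count (fun t => π t = a) s) ≤
        ∑ a, (Nat.count (fun t => π t = a) τ - Nat.count (fun t => π t = a) s) := by
      refine le_trans (Finset.sum_le_sum fun a ha => ?_)
        (Finset.sum_le_sum_of_subset (Finset.subset_univ Z))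
      have := hπ a ha
      omega
    have h2 : ∑ a, (Nat.count (fun t => π t = a) τ - Nat.count (fun t => π t = a) s)
        + ∑ a, Nat.count (fun t => π t = a) s = ∑ a, Nat.count (fun t => π t = a) τ := by
      rw [← Finset.sum_add_distrib]
      refine Finset.sum_congr rfl fun a _ => ?_
      have := Nat.count_monotone (fun t => π t = a) hs
      omega
    rw [sum_count, sum_count] at h2
    omega
  have hst : ∀ s, s ≤ τ → stateArm τ δ Z π s = fun a => Nat.count (fun t => π t = a) s := by
    intro s
    induction s with
    | zero => intro _; funext a; simp [stateArm]
    | succ s ih =>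
      intro hs
      have ih := ih (by omega)
      have : stepArm τ δ Z (π s) s (stateArm τ δ Z π s) = π s := by
        unfold stepArm
        rw [if_pos]
        have := hneed (s + 1) hs
        simp only [Nat.count_succ] at this
        rw [ih]
        exact this
      funext a
      simp only [stateArm, this, Nat.count_succ]
      rw [ih]
  unfold corr stepArm
  rw [if_pos]
  have := hneed (s + 1) hs
  simp only [Nat.count_succ] at this
  rw [hst s hs.le]
  exact this

/-! ### The preferred arms -/

theorem count_eq_sum (p : ℕ → Prop) [DecidablePred p] (T : ℕ) :
    Nat.count p T = ∑ t ∈ Finset.range T, if p t then 1 else 0 := by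
  rw [Nat.count_eq_card_filter_range, Finset.card_filter]

noncomputable def label {n : ℕ} (c : Fin n → ℕ) (w : ℕ → Fin n) (t : ℕ) : Fin (n + 1) :=
  if Nat.count (fun s => w s = w t) t < c (w t) then (w t).castSucc else Fin.last n

noncomputable def pref {k n : ℕ} (L : Fin (n + 1) → ℕ → Fin k) (c : Fin n → ℕ) (w : ℕ → Fin n)
    (t : ℕ) : Fin k :=
  L (label c w t) (Nat.count (fun s => label c w s = label c w t) t)

theorem count_congr' {p q : ℕ → Prop} [DecidablePred p] [DecidablePred q] {T : ℕ}
    (h : ∀ s, s < T → (p s ↔ q s)) : Nat.count p T = Nat.count q T := by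
  rw [Nat.count_eq_card_filter_range, Nat.count_eq_card_filter_range]
  congr 1
  exact Finset.filter_congr fun s hs => h s (Finset.mem_range.1 hs)

theorem label_congr {n : ℕ} (c : Fin n → ℕ) (w w' : ℕ → Fin n) (t : ℕ)
    (h : ∀ l, l ≤ t → w l = w' l) : label c w t = label c w' t := by
  unfold label
  rw [h t le_rfl, count_congr' (q := fun s => w' s = w' t) fun s hs => by rw [h s hs.le]]

theorem pref_congr {k n : ℕ} (L : Fin (n + 1) → ℕ → Fin k) (c : Fin n → ℕ) (w w' : ℕ → Fin n)
    (t : ℕ) (h : ∀ l, l ≤ t → w l = w' l) : pref L c w t = pref L c w' t := by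
  unfold pref
  rw [label_congr c w w' t h, count_congr' (q := fun s => label c w' s = label c w' t)]
  intro s hs
  rw [label_congr c w w' s fun l hl => h l (by omega)]

theorem label_count {n : ℕ} (c : Fin n → ℕ) (w : ℕ → Fin n) (τ : ℕ)
    (hg : ∀ u, c u ≤ Nat.count (fun s => w s = u) τ) (x : Fin (n + 1)) :
    Nat.count (fun s => label c w s = x) τ
      = (Fin.snoc c (τ - ∑ u, c u) : Fin (n + 1) → ℕ) x := by
  have h1 : ∀ u : Fin n, Nat.count (fun s => label c w s = u.castSucc) τ = c u := by
    intro u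
    have e := sum_occ w u (fun i => if i < c u then 1 else 0) τ
    have e2 : ∑ i ∈ Finset.range (Nat.count (fun s => w s = u) τ), (if i < c u then 1 else 0)
        = c u := by
      rw [← Finset.card_filter]
      have : (Finset.range (Nat.count (fun s => w s = u) τ)).filter (fun i => i < c u)
          = Finset.range (c u) := by
        ext i
        have := hg u
        simp only [Finset.mem_filter, Finset.mem_range]
        omega
      rw [this, Finset.card_range]
    rw [e2] at e
    rw [count_eq_sum, ← e]
    refine Finset.sum_congr rfl fun t _ => ?_
    unfold label
    by_cases hw : w t = u
    · subst hw
      by_cases h2 : Nat.count (fun s => w s = w t) t < c (w t)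
      · simp [h2]
      · simp [h2, (Fin.castSucc_ne_last (w t)).symm]
    · rw [if_neg hw, if_neg]
      split_ifs
      · simpa using hw
      · exact (Fin.castSucc_ne_last u).symm
  refine Fin.lastCases ?_ (fun u => ?_) x
  · have := sum_count (label c w) τ
    rw [Fin.sum_univ_castSucc, Finset.sum_congr rfl fun u _ => h1 u] at this
    rw [Fin.snoc_last]
    exact Nat.eq_sub_of_add_eq' this
  · rw [Fin.snoc_castSucc, h1]

theorem pref_count {k n : ℕ} (L : Fin (n + 1) → ℕ → Fin k) (c : Fin n → ℕ) (w : ℕ → Fin n) (τ : ℕ)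
    (x : Fin (n + 1)) (a : Fin k) :
    Nat.count (fun s => label c w s = x ∧ pref L c w s = a) τ
      = Nat.count (fun i => L x i = a) (Nat.count (fun s => label c w s = x) τ) := by
  rw [count_eq_sum (fun i => L x i = a), ← sum_occ, count_eq_sum]
  refine Finset.sum_congr rfl fun t _ => ?_
  unfold pref
  by_cases h : label c w t = x
  · subst h; simp
  · simp [h]

/-- Rows of a matrix as sequences. -/
theorem row_seq {k : ℕ} (c : ℕ) (M : Fin k → ℕ) (hM : ∑ a, M a = c) (Z : Finset (Fin k))
    (hZ : ∀ a, a ∉ Z → M a = 0) (z0 : Fin k) (hz : z0 ∈ Z) :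
    ∃ L : ℕ → Fin k, (∀ i, L i ∈ Z) ∧ ∀ a, Nat.count (fun i => L i = a) c = M a := by
  obtain ⟨v, hv, -⟩ := retype_seq c M hM _ (fun _ => z0) rfl
  refine ⟨fun i => if i < c then v i else z0, ?_, ?_⟩
  · intro i
    by_cases h : i < c
    · simp only [h, if_true]
      by_contra hn
      have h0 := hv (v i)
      rw [hZ _ hn, Nat.count_eq_card_filter_range, Finset.card_eq_zero,
        Finset.filter_eq_empty_iff] at h0
      exact h0 (Finset.mem_range.2 h) rfl
    · simpa only [h, if_false] using hz
  · intro a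
    rw [← hv a]
    exact count_congr' fun s hs => by simp [hs]

/-! ### Probability -/

theorem sum_seqProb_prod {n : ℕ} (T : ℕ) (P : Fin n → ℝ) (g : Fin T → Fin n → ℝ) :
    ∑ q : Fin T → Fin n, seqProb T P q * ∏ t, g t (q t) = ∏ t, ∑ u, P u * g t u := by
  unfold seqProb
  rw [Finset.prod_univ_sum]
  simp [Finset.prod_mul_distrib]

theorem sum_seqProb {n : ℕ} (T : ℕ) (P : Fin n → ℝ) (h : ∑ u, P u = 1) :
    ∑ q : Fin T → Fin n, seqProb T P q = 1 := by
  have := sum_seqProb_prod T P fun _ _ => 1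
  simpa [h] using this

theorem seqProb_nonneg {n : ℕ} (T : ℕ) (P : Fin n → ℝ) (h : ∀ u, 0 < P u) (q : Fin T → Fin n) :
    0 ≤ seqProb T P q := Finset.prod_nonneg fun _ _ => (h _).le

theorem exp_le_cosh_sinh (l y : ℝ) (h1 : -1 ≤ y) (h2 : y ≤ 1) :
    Real.exp (l * y) ≤ Real.cosh l + y * Real.sinh l := by
  have hc := convexOn_exp.2 (Set.mem_univ l) (Set.mem_univ (-l))
    (by linarith : 0 ≤ (1 + y) / 2) (by linarith : 0 ≤ (1 - y) / 2) (by ring)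
  simp only [smul_eq_mul] at hc
  rw [Real.cosh_eq, Real.sinh_eq]
  have e : (1 + y) / 2 * l + (1 - y) / 2 * -l = l * y := by ring
  rw [e] at hc
  linarith

theorem mgf_one {n : ℕ} (P : Fin n → ℝ) (hP : ∀ u, 0 < P u) (h1 : ∑ u, P u = 1) (u : Fin n)
    (l : ℝ) :
    ∑ x, P x * Real.exp (l * ((if x = u then 1 else 0) - P u)) ≤ Real.exp (l ^ 2 / 2) := by
  have hPu : P u ≤ 1 := by
    rw [← h1]; exact Finset.single_le_sum (fun i _ => (hP i).le) (Finset.mem_univ u)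
  calc _ ≤ ∑ x, P x * (Real.cosh l + ((if x = u then 1 else 0) - P u) * Real.sinh l) := by
        refine Finset.sum_le_sum fun x _ => mul_le_mul_of_nonneg_left ?_ (hP x).le
        have := hP u
        apply exp_le_cosh_sinh <;> split_ifs <;> linarith
    _ = Real.cosh l := by
        have : ∀ x, P x * (Real.cosh l + ((if x = u then 1 else 0) - P u) * Real.sinh l)
            = P x * (Real.cosh l - P u * Real.sinh l) + (if x = u then P x * Real.sinh l else 0) := by
          intro x; split_ifs <;> ring
        rw [Finset.sum_congr rfl fun x _ => this x, Finset.sum_add_distrib, ← Finset.sum_mul, h1]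
        simp
    _ ≤ _ := Real.cosh_le_exp_half_sq l

theorem mgf_phase {n : ℕ} (T : ℕ) (P : Fin n → ℝ) (hP : ∀ u, 0 < P u) (h1 : ∑ u, P u = 1)
    (u : Fin n) (l : ℝ) (S : Finset (Fin T)) :
    ∑ q : Fin T → Fin n, seqProb T P q *
        Real.exp (l * ∑ t ∈ S, ((if q t = u then 1 else 0) - P u))
      ≤ Real.exp (l ^ 2 / 2 * S.card) := by
  have e : ∀ q : Fin T → Fin n, Real.exp (l * ∑ t ∈ S, ((if q t = u then 1 else 0) - P u))
      = ∏ t, (fun t x => if t ∈ S then Real.exp (l * ((if x = u then 1 else 0) - P u)) else 1)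
        t (q t) := by
    intro q
    rw [Finset.mul_sum, Real.exp_sum, Finset.prod_ite_mem, Finset.univ_inter]
  have e2 := sum_seqProb_prod T P (fun t x => if t ∈ S then
    Real.exp (l * ((if x = u then 1 else 0) - P u)) else 1)
  rw [Finset.sum_congr rfl fun q _ => by rw [e q]]
  refine e2.le.trans ?_
  calc _ ≤ ∏ t, (if t ∈ S then Real.exp (l ^ 2 / 2) else 1) := by
        refine Finset.prod_le_prod ?_ ?_
        · intro t _
          refine Finset.sum_nonneg fun x _ => mul_nonneg (hP x).le ?_
          split_ifs <;> positivity
        · intro t _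
          by_cases h : t ∈ S
          · simp only [h, if_true]
            exact mgf_one P hP h1 u l
          · simp [h, h1]
    _ = _ := by
        rw [Finset.prod_ite_mem, Finset.univ_inter, Finset.prod_const, ← Real.exp_nat_mul]
        ring_nf

/-- The centred count of type `u` in a phase. -/
noncomputable def dev {n : ℕ} (N τ : ℕ) (P : Fin n → ℝ) (u : Fin n) (j : ℕ)
    (q : Fin (N * τ) → Fin n) : ℝ :=
  ∑ t ∈ Finset.univ.filter (fun t : Fin (N * τ) => j * τ ≤ (t : ℕ) ∧ (t : ℕ) < (j + 1) * τ),
    ((if q t = u then 1 else 0) - P u)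

theorem mgf_dev {n : ℕ} (N τ : ℕ) (P : Fin n → ℝ) (hP : ∀ u, 0 < P u) (h1 : ∑ u, P u = 1)
    (u : Fin n) (l : ℝ) (j : ℕ) (hj : j < N) :
    ∑ q : Fin (N * τ) → Fin n, seqProb (N * τ) P q * Real.exp (l * dev N τ P u j q)
      ≤ Real.exp (l ^ 2 / 2 * τ) := by
  have := mgf_phase (N * τ) P hP h1 u l
    (Finset.univ.filter (fun t : Fin (N * τ) => j * τ ≤ (t : ℕ) ∧ (t : ℕ) < (j + 1) * τ))
  rw [Finset.card_eq_sum_ones, bridge_phase (fun _ => 1) (fun _ => 1) hj (fun _ _ _ => rfl)] at this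
  simpa [dev] using this

/-- `E[(N_u - P_u τ)^+] ≤ 2 √τ`. -/
theorem pos_dev {n : ℕ} (N τ : ℕ) (hτ : 2 ≤ τ) (P : Fin n → ℝ) (hP : ∀ u, 0 < P u)
    (h1 : ∑ u, P u = 1) (u : Fin n) (j : ℕ) (hj : j < N) :
    ∑ q : Fin (N * τ) → Fin n, seqProb (N * τ) P q * max (dev N τ P u j q) 0
      ≤ 2 * Real.sqrt τ := by
  have hτ0 : (0 : ℝ) < τ := by exact_mod_cast (by omega : 0 < τ)
  have hs : 0 < Real.sqrt τ := Real.sqrt_pos.2 hτ0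
  have hm := mgf_dev N τ P hP h1 u (1 / Real.sqrt τ) j hj
  have e : (1 / Real.sqrt τ) ^ 2 / 2 * τ = 1 / 2 := by
    rw [div_pow, Real.sq_sqrt hτ0.le]; field_simp
  rw [e] at hm
  have he : Real.exp (1 / 2) ≤ 2 := by
    have h2 := Real.exp_one_lt_d9
    have : Real.exp (1 / 2) * Real.exp (1 / 2) = Real.exp 1 := by rw [← Real.exp_add]; norm_num
    nlinarith [Real.exp_pos (1 / 2)]
  calc _ ≤ ∑ q : Fin (N * τ) → Fin n,
        Real.sqrt τ * (seqProb (N * τ) P q * Real.exp (1 / Real.sqrt τ * dev N τ P u j q)) := by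
        refine Finset.sum_le_sum fun q _ => ?_
        rw [mul_left_comm]
        refine mul_le_mul_of_nonneg_left ?_ (seqProb_nonneg _ P hP q)
        refine max_le ?_ (by positivity)
        have := Real.add_one_le_exp (1 / Real.sqrt τ * dev N τ P u j q)
        calc dev N τ P u j q = Real.sqrt τ * (1 / Real.sqrt τ * dev N τ P u j q) := by field_simp
          _ ≤ _ := mul_le_mul_of_nonneg_left (by linarith) hs.le
    _ = Real.sqrt τ * ∑ q : Fin (N * τ) → Fin n,
          seqProb (N * τ) P q * Real.exp (1 / Real.sqrt τ * dev N τ P u j q) := by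
        rw [Finset.mul_sum]
    _ ≤ _ := by nlinarith

/-- The lower tail: `P(N_u - P_u τ ≤ -√(τ log τ)) ≤ 1/√τ`. -/
theorem tail_dev {n : ℕ} (N τ : ℕ) (hτ : 2 ≤ τ) (P : Fin n → ℝ) (hP : ∀ u, 0 < P u)
    (h1 : ∑ u, P u = 1) (u : Fin n) (j : ℕ) (hj : j < N) :
    ∑ q : Fin (N * τ) → Fin n, seqProb (N * τ) P q *
        (if dev N τ P u j q ≤ - Real.sqrt (τ * Real.log τ) then 1 else 0)
      ≤ 1 / Real.sqrt τ := by
  have hτ0 : (0 : ℝ) < τ := by exact_mod_cast (by omega : 0 < τ)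
  have hs : 0 < Real.sqrt τ := Real.sqrt_pos.2 hτ0
  have hl : 0 ≤ Real.log τ := Real.log_natCast_nonneg τ
  set l := Real.sqrt (Real.log τ) / Real.sqrt τ with hldef
  have hl0 : 0 ≤ l := by positivity
  have hm := mgf_dev N τ P hP h1 u (-l) j hj
  have e : (-l) ^ 2 / 2 * τ = Real.log τ / 2 := by
    rw [neg_sq, hldef, div_pow, Real.sq_sqrt hτ0.le, Real.sq_sqrt hl]; field_simp
  have e2 : l * Real.sqrt (τ * Real.log τ) = Real.log τ := by
    rw [Real.sqrt_mul hτ0.le, hldef]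
    field_simp
    exact Real.sq_sqrt hl
  rw [e] at hm
  calc _ ≤ ∑ q : Fin (N * τ) → Fin n,
        Real.exp (-Real.log τ) * (seqProb (N * τ) P q * Real.exp (-l * dev N τ P u j q)) := by
        refine Finset.sum_le_sum fun q _ => ?_
        rw [mul_left_comm]
        refine mul_le_mul_of_nonneg_left ?_ (seqProb_nonneg _ P hP q)
        split_ifs with h
        · rw [← Real.exp_add]
          apply Real.one_le_exp
          nlinarith
        · positivity
    _ = Real.exp (-Real.log τ) * ∑ q : Fin (N * τ) → Fin n,
          seqProb (N * τ) P q * Real.exp (-l * dev N τ P u j q) := by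
        rw [Finset.mul_sum]
    _ ≤ Real.exp (-Real.log τ) * Real.exp (Real.log τ / 2) :=
        mul_le_mul_of_nonneg_left hm (Real.exp_pos _).le
    _ = 1 / Real.sqrt τ := by
        rw [← Real.exp_add, Real.sqrt_eq_rpow, Real.rpow_def_of_pos hτ0, one_div, ← Real.exp_neg]
        ring_nf

/-! ### Segments of the arrival sequence -/

def seg {X : Type*} {N τ : ℕ} (x0 : X) (q : Fin (N * τ) → X) (j s : ℕ) : X :=
  if h : j * τ + s < N * τ then q ⟨j * τ + s, h⟩ else x0

theorem seg_eq {X : Type*} {N τ : ℕ} (x0 : X) (q : Fin (N * τ) → X) (j s : ℕ)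
    (h : j * τ + s < N * τ) : seg x0 q j s = q ⟨j * τ + s, h⟩ := dif_pos h

theorem pulls_eq {k N τ : ℕ} (pull : Fin (N * τ) → Fin k) {j : ℕ} (hj : j < N) (a : Fin k)
    (p : ℕ → Fin k) (h : ∀ s, s < τ → ∀ hh : j * τ + s < N * τ, pull ⟨j * τ + s, hh⟩ = p s) :
    pullsInPhase (N * τ) τ pull j a = Nat.count (fun s => p s = a) τ := by
  unfold pullsInPhase
  have : (Finset.univ.filter (fun t : Fin (N * τ) =>
      j * τ ≤ (t : ℕ) ∧ (t : ℕ) < (j + 1) * τ ∧ pull t = a))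
      = (Finset.univ.filter (fun t : Fin (N * τ) => j * τ ≤ (t : ℕ) ∧ (t : ℕ) < (j + 1) * τ)).filter
        (fun t => pull t = a) := by
    rw [Finset.filter_filter]
    simp only [and_assoc]
  rw [this, Finset.card_filter, count_eq_sum]
  exact bridge_phase (fun t => if pull t = a then 1 else 0) _ hj
    (fun s hs hh => by simp only [h s hs hh])

theorem seqReward_committed {k n N τ : ℕ} (hτ : 0 < τ) (μ : Fin n → Fin k → ℝ) (δ : Fin k → ℕ)
    (Z : Finset (Fin k)) (A : Alg k n (N * τ)) (hA : Committed τ δ Z A) (q : Fin (N * τ) → Fin n)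
    (u0 : Fin n) (a0 : Fin k) :
    seqReward (N * τ) τ μ δ (A.1 q) q
      = ∑ j ∈ Finset.range N, ∑ s ∈ Finset.range τ,
          μ (seg u0 q j s) (seg a0 (A.1 q) j s) := by
  unfold seqReward
  apply bridge_all hτ
  intro j hj s hs hh
  rw [if_pos, seg_eq _ _ _ _ hh, seg_eq _ _ _ _ hh]
  intro i hi
  exact (hA q).2 i (hi.trans (by simpa using hh.le)) _ ((hA q).1 _)

theorem dev_eq {n : ℕ} (N τ : ℕ) (P : Fin n → ℝ) (u : Fin n) (j : ℕ) (hj : j < N)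
    (q : Fin (N * τ) → Fin n) (u0 : Fin n) :
    dev N τ P u j q = (Nat.count (fun s => seg u0 q j s = u) τ : ℝ) - P u * τ := by
  unfold dev
  rw [bridge_phase _ (fun s => (if seg u0 q j s = u then 1 else 0) - P u) hj
    (fun s hs hh => by rw [seg_eq _ _ _ _ hh])]
  rw [Finset.sum_sub_distrib, count_eq_sum]
  push_cast
  simp [mul_comm]

/-! ### The offline value -/

def valSet {k m : ℕ} (μ : Fin m → Fin k → ℝ) (δ : Fin k → ℕ) (c : Fin m → ℕ)
    (Z : Finset (Fin k)) : Set ℝ :=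
  {r : ℝ | ∃ M : Fin m → Fin k → ℕ,
    (∀ u, ∑ a, M u a = c u) ∧ (∀ u a, a ∉ Z → M u a = 0) ∧
    (∀ a ∈ Z, δ a ≤ ∑ u, M u a) ∧
    r = ∑ u, ∑ a, (M u a : ℝ) * μ u a}

theorem valSet_finite {k m : ℕ} (μ : Fin m → Fin k → ℝ) (δ : Fin k → ℕ) (c : Fin m → ℕ)
    (Z : Finset (Fin k)) : (valSet μ δ c Z).Finite := by
  refine ((Set.finite_Iic (fun (u : Fin m) (_ : Fin k) => c u)).image
    (fun M => ∑ u, ∑ a, (M u a : ℝ) * μ u a)).subset ?_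
  rintro r ⟨M, h1, -, -, rfl⟩
  refine ⟨M, ?_, rfl⟩
  intro u a
  simp only
  rw [← h1 u]
  exact Finset.single_le_sum (f := fun a => M u a) (fun _ _ => Nat.zero_le _) (Finset.mem_univ a)

theorem mem_valSet {k m τ : ℕ} (μ : Fin m → Fin k → ℝ) (δ : Fin k → ℕ) (c : Fin m → ℕ)
    (Z : Finset (Fin k)) (v : ℕ → Fin m) (p : ℕ → Fin k)
    (hv : ∀ x, Nat.count (fun s => v s = x) τ = c x) (hp : ∀ s, s < τ → p s ∈ Z)
    (hd : ∀ a ∈ Z, δ a ≤ Nat.count (fun s => p s = a) τ) :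
    ∑ t ∈ Finset.range τ, μ (v t) (p t) ∈ valSet μ δ c Z := by
  refine ⟨fun u a => Nat.count (fun s => v s = u ∧ p s = a) τ, ?_, ?_, ?_, ?_⟩
  · intro u; rw [sum_count_right, hv]
  · intro u a ha
    simp only
    rw [Nat.count_eq_card_filter_range, Finset.card_eq_zero, Finset.filter_eq_empty_iff]
    rintro s hs ⟨-, h⟩
    exact ha (h ▸ hp s (Finset.mem_range.1 hs))
  · intro a ha; rw [sum_count_left]; exact hd a ha
  · exact (matrix_value v p μ τ).symm

theorem valSet_nonempty {k m τ : ℕ} (μ : Fin m → Fin k → ℝ) (δ : Fin k → ℕ) (c : Fin m → ℕ)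
    (hc : ∑ x, c x = τ) (hm : 0 < m) (Z : Finset (Fin k)) (hZ : Z.Nonempty)
    (hd : ∑ a ∈ Z, δ a ≤ τ) : (valSet μ δ c Z).Nonempty := by
  obtain ⟨z, hz⟩ := hZ
  obtain ⟨v, hv, -⟩ := retype_seq τ c hc _ (fun _ => (⟨0, hm⟩ : Fin m)) rfl
  exact ⟨_, mem_valSet μ δ c Z v (corr τ δ Z fun _ => z) hv
    (fun s _ => corr_mem _ _ _ _ _ hz) (fun a ha => corr_feasible _ _ _ _ hd a ha)⟩

theorem muPlus_bounds {k n : ℕ} (μ : Fin n → Fin k → ℝ) (hμ : ∀ u a, 0 ≤ μ u a ∧ μ u a ≤ 1)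
    (x : Fin (n + 1)) (a : Fin k) : 0 ≤ muPlus μ x a ∧ muPlus μ x a ≤ 1 := by
  unfold muPlus
  refine Fin.lastCases ?_ (fun u => ?_) x
  · simp
  · simpa using hμ u a

theorem cplus_sum {n : ℕ} (P : Fin n → ℝ) (τ : ℕ) (h : ∑ u, cplusBase P τ u ≤ τ) :
    ∑ x, cplus P τ x = τ := by
  unfold cplus
  rw [Fin.sum_univ_castSucc]
  simp only [Fin.snoc_castSucc, Fin.snoc_last]
  exact Nat.add_sub_of_le h

theorem upper_phase {k n τ : ℕ} (P : Fin n → ℝ) (μ : Fin n → Fin k → ℝ)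
    (hμ : ∀ u a, 0 ≤ μ u a ∧ μ u a ≤ 1) (δ : Fin k → ℕ) (h : ∑ u, cplusBase P τ u ≤ τ)
    (Z : Finset (Fin k)) (w : ℕ → Fin n) (p : ℕ → Fin k) (hp : ∀ s, s < τ → p s ∈ Z)
    (hd : ∀ a ∈ Z, δ a ≤ Nat.count (fun s => p s = a) τ) :
    ∑ s ∈ Finset.range τ, μ (w s) (p s) ≤ DOAlgR (muPlus μ) δ (cplus P τ) Z
      + ∑ u, (((Nat.count (fun s => w s = u) τ - cplusBase P τ u : ℕ)) : ℝ) := by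
  obtain ⟨v, hv, hcard⟩ := retype_seq τ (cplus P τ) (cplus_sum P τ h) _ (fun s => (w s).castSucc) rfl
  have hmem := mem_valSet (muPlus μ) δ (cplus P τ) Z v p hv hp hd
  have h1 : ∑ t ∈ Finset.range τ, muPlus μ (v t) (p t) ≤ DOAlgR (muPlus μ) δ (cplus P τ) Z :=
    le_csSup (valSet_finite _ _ _ _).bddAbove hmem
  have h2 : ∑ x, (Nat.count (fun s => (w s).castSucc = x) τ - cplus P τ x)
      = ∑ u, (Nat.count (fun s => w s = u) τ - cplusBase P τ u) := by
    rw [Fin.sum_univ_castSucc]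
    have : Nat.count (fun s => (w s).castSucc = Fin.last n) τ = 0 := by
      rw [Nat.count_eq_card_filter_range, Finset.card_eq_zero, Finset.filter_eq_empty_iff]
      intro s _
      exact Fin.castSucc_ne_last _
    rw [this, Nat.zero_sub, add_zero]
    refine Finset.sum_congr rfl fun u _ => ?_
    simp [cplus]
  rw [h2] at hcard
  have h3 : ∑ s ∈ Finset.range τ, μ (w s) (p s) ≤ ∑ t ∈ Finset.range τ, muPlus μ (v t) (p t)
      + (((Finset.range τ).filter (fun s => v s ≠ (w s).castSucc)).card : ℝ) := by
    rw [Finset.card_filter]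
    push_cast
    rw [← Finset.sum_add_distrib]
    refine Finset.sum_le_sum fun s _ => ?_
    by_cases hs : v s = (w s).castSucc
    · simp [hs, muPlus]
    · rw [if_pos hs]
      have := (hμ (w s) (p s)).2
      have := (muPlus_bounds μ hμ (v s) (p s)).1
      linarith
  have h4 : (((Finset.range τ).filter (fun s => v s ≠ (w s).castSucc)).card : ℝ)
      ≤ ∑ u, (((Nat.count (fun s => w s = u) τ - cplusBase P τ u : ℕ)) : ℝ) := by
    exact_mod_cast hcard
  linarith

theorem lower_phase {k n τ : ℕ} (P : Fin n → ℝ) (μ : Fin n → Fin k → ℝ)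
    (hμ : ∀ u a, 0 ≤ μ u a ∧ μ u a ≤ 1) (δ : Fin k → ℕ)
    (Z : Finset (Fin k)) (M : Fin (n + 1) → Fin k → ℕ)
    (hM3 : ∀ a ∈ Z, δ a ≤ ∑ u, M u a)
    (L : Fin (n + 1) → ℕ → Fin k)
    (hL2 : ∀ x a, Nat.count (fun i => L x i = a) (cplus P τ x) = M x a)
    (w : ℕ → Fin n) (hg : ∀ u, cplusBase P τ u ≤ Nat.count (fun s => w s = u) τ) :
    ∑ u, ∑ a, (M u a : ℝ) * muPlus μ u a
      ≤ ∑ s ∈ Finset.range τ, μ (w s) (corr τ δ Z (pref L (cplusBase P τ) w) s) := by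
  have hcount : ∀ x a, Nat.count (fun s => label (cplusBase P τ) w s = x ∧
      pref L (cplusBase P τ) w s = a) τ = M x a := by
    intro x a
    rw [pref_count, label_count _ _ _ hg]
    exact hL2 x a
  have hfeas : ∀ a ∈ Z, δ a ≤ Nat.count (fun t => pref L (cplusBase P τ) w t = a) τ := by
    intro a ha
    rw [← sum_count_left (label (cplusBase P τ) w)]
    simp only [hcount]
    exact hM3 a ha
  have hval := matrix_value (label (cplusBase P τ) w) (pref L (cplusBase P τ) w) (muPlus μ) τ
  simp only [hcount] at hval
  rw [hval]
  refine Finset.sum_le_sum fun s hs => ?_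
  rw [corr_eq τ δ Z _ hfeas s (Finset.mem_range.1 hs)]
  generalize pref L (cplusBase P τ) w s = a
  unfold label muPlus
  split_ifs
  · simp
  · simpa using (hμ (w s) a).1

/-! ### The algorithm -/

noncomputable def lcbFun {k n N : ℕ} (τ : ℕ) (δ : Fin k → ℕ) (Z : Finset (Fin k))
    (L : Fin (n + 1) → ℕ → Fin k) (c : Fin n → ℕ) (u0 : Fin n) (q : Fin (N * τ) → Fin n)
    (t : Fin (N * τ)) : Fin k :=
  corr τ δ Z (pref L c (seg u0 q ((t : ℕ) / τ))) ((t : ℕ) % τ)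

theorem lcbFun_idx {k n N : ℕ} (τ : ℕ) (δ : Fin k → ℕ) (Z : Finset (Fin k))
    (L : Fin (n + 1) → ℕ → Fin k) (c : Fin n → ℕ) (u0 : Fin n) (q : Fin (N * τ) → Fin n)
    (j s : ℕ) (hs : s < τ) (hh : j * τ + s < N * τ) :
    lcbFun τ δ Z L c u0 q ⟨j * τ + s, hh⟩ = corr τ δ Z (pref L c (seg u0 q j)) s := by
  have h1 : (j * τ + s) / τ = j := by
    rw [mul_comm, Nat.mul_add_div (by omega), Nat.div_eq_of_lt hs, add_zero]
  have h2 : (j * τ + s) % τ = s := by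
    rw [mul_comm, Nat.mul_add_mod, Nat.mod_eq_of_lt hs]
  simp only [lcbFun, h1, h2]

theorem lcb_congr {k n : ℕ} (τ : ℕ) (δ : Fin k → ℕ) (Z : Finset (Fin k))
    (L : Fin (n + 1) → ℕ → Fin k) (c : Fin n → ℕ) (w w' : ℕ → Fin n) (s : ℕ)
    (h : ∀ l, l ≤ s → w l = w' l) :
    corr τ δ Z (pref L c w) s = corr τ δ Z (pref L c w') s :=
  corr_congr _ _ _ _ _ _ fun l hl => pref_congr _ _ _ _ _ fun i hi => h i (hi.trans hl)

theorem lcbFun_causal {k n N : ℕ} (τ : ℕ) (δ : Fin k → ℕ) (Z : Finset (Fin k))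
    (L : Fin (n + 1) → ℕ → Fin k) (c : Fin n → ℕ) (u0 : Fin n) :
    Causal (lcbFun (N := N) τ δ Z L c u0) := by
  intro q q' t h
  apply lcb_congr
  intro l hl
  have hle : (t : ℕ) / τ * τ + l ≤ t := by
    have := Nat.div_add_mod' (t : ℕ) τ
    omega
  have hlt := lt_of_le_of_lt hle t.2
  rw [seg_eq _ _ _ _ hlt, seg_eq _ _ _ _ hlt]
  exact h _ hle

theorem lcbFun_phaseInd {k n N : ℕ} (τ : ℕ) (δ : Fin k → ℕ) (Z : Finset (Fin k))
    (L : Fin (n + 1) → ℕ → Fin k) (c : Fin n → ℕ) (u0 : Fin n) :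
    PhaseInd τ (⟨lcbFun (N := N) τ δ Z L c u0, lcbFun_causal τ δ Z L c u0⟩ : Alg k n (N * τ)) := by
  intro q i j s hs hi hj h
  simp only
  rw [lcbFun_idx _ _ _ _ _ _ _ _ _ hs, lcbFun_idx _ _ _ _ _ _ _ _ _ hs]
  apply lcb_congr
  intro l hl
  rw [seg_eq _ _ _ _ (by omega), seg_eq _ _ _ _ (by omega)]
  exact h l hl _ _

theorem lcbFun_committed {k n N : ℕ} (τ : ℕ) (hτ : 0 < τ) (δ : Fin k → ℕ) (Z : Finset (Fin k))
    (L : Fin (n + 1) → ℕ → Fin k) (hL : ∀ x i, L x i ∈ Z) (hd : ∑ a ∈ Z, δ a ≤ τ)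
    (c : Fin n → ℕ) (u0 : Fin n) :
    Committed τ δ Z
      (⟨lcbFun (N := N) τ δ Z L c u0, lcbFun_causal τ δ Z L c u0⟩ : Alg k n (N * τ)) := by
  intro q
  refine ⟨fun t => corr_mem _ _ _ _ _ (hL _ _), ?_⟩
  intro j hj a ha
  have hj' : j < N := Nat.lt_of_succ_le (Nat.le_of_mul_le_mul_right hj hτ)
  rw [pulls_eq _ hj' a (corr τ δ Z (pref L c (seg u0 q j)))
    (fun s hs hh => lcbFun_idx _ _ _ _ _ _ _ _ _ hs hh)]
  exact corr_feasible _ _ _ _ hd a ha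

/-! ### Expectations -/

theorem expReward_ge {k n N τ : ℕ} (P : Fin n → ℝ) (hP : ∀ u, 0 < P u) (h1 : ∑ u, P u = 1)
    (μ : Fin n → Fin k → ℝ) (δ : Fin k → ℕ) (A : Alg k n (N * τ)) (D b t : ℝ) (ht : 0 ≤ t)
    (X : Fin n → ℕ → (Fin (N * τ) → Fin n) → ℝ)
    (hA : ∀ q, ∑ j ∈ Finset.range N, (D - t * ∑ u, X u j q) ≤ seqReward (N * τ) τ μ δ (A.1 q) q)
    (hX : ∀ u j, j < N → ∑ q, seqProb (N * τ) P q * X u j q ≤ b) :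
    N * (D - t * (n * b)) ≤ expReward (N * τ) τ P μ δ A := by
  unfold expReward
  calc (N : ℝ) * (D - t * (n * b)) = ∑ j ∈ Finset.range N, (D - t * ∑ u : Fin n, b) := by
        simp [mul_sub]
    _ ≤ ∑ j ∈ Finset.range N, (D - t * ∑ u, ∑ q, seqProb (N * τ) P q * X u j q) := by
        refine Finset.sum_le_sum fun j hj => ?_
        have : ∑ u, ∑ q, seqProb (N * τ) P q * X u j q ≤ ∑ u : Fin n, b :=
          Finset.sum_le_sum fun u _ => hX u j (Finset.mem_range.1 hj)
        nlinarith
    _ = ∑ j ∈ Finset.range N, ∑ q, seqProb (N * τ) P q * (D - t * ∑ u, X u j q) := by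
        refine Finset.sum_congr rfl fun j _ => ?_
        simp only [mul_sub, Finset.sum_sub_distrib, ← Finset.sum_mul, sum_seqProb _ P h1, one_mul]
        congr 1
        rw [Finset.sum_comm, Finset.mul_sum]
        refine Finset.sum_congr rfl fun q _ => ?_
        rw [← Finset.mul_sum]; ring
    _ = ∑ q, seqProb (N * τ) P q * ∑ j ∈ Finset.range N, (D - t * ∑ u, X u j q) := by
        rw [Finset.sum_comm]
        simp only [Finset.mul_sum]
    _ ≤ _ := Finset.sum_le_sum fun q _ =>
        mul_le_mul_of_nonneg_left (hA q) (seqProb_nonneg _ P hP q)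

theorem expReward_le {k n N τ : ℕ} (P : Fin n → ℝ) (hP : ∀ u, 0 < P u) (h1 : ∑ u, P u = 1)
    (μ : Fin n → Fin k → ℝ) (δ : Fin k → ℕ) (A : Alg k n (N * τ)) (D b : ℝ)
    (X : Fin n → ℕ → (Fin (N * τ) → Fin n) → ℝ)
    (hA : ∀ q, seqReward (N * τ) τ μ δ (A.1 q) q ≤ ∑ j ∈ Finset.range N, (D + ∑ u, X u j q))
    (hX : ∀ u j, j < N → ∑ q, seqProb (N * τ) P q * X u j q ≤ b) :
    expReward (N * τ) τ P μ δ A ≤ N * (D + n * b) := by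
  unfold expReward
  calc _ ≤ ∑ q, seqProb (N * τ) P q * ∑ j ∈ Finset.range N, (D + ∑ u, X u j q) :=
        Finset.sum_le_sum fun q _ => mul_le_mul_of_nonneg_left (hA q) (seqProb_nonneg _ P hP q)
    _ = ∑ j ∈ Finset.range N, ∑ q, seqProb (N * τ) P q * (D + ∑ u, X u j q) := by
        rw [Finset.sum_comm]
        simp only [Finset.mul_sum]
    _ = ∑ j ∈ Finset.range N, (D + ∑ u, ∑ q, seqProb (N * τ) P q * X u j q) := by
        refine Finset.sum_congr rfl fun j _ => ?_
        simp only [mul_add, Finset.sum_add_distrib, ← Finset.sum_mul, sum_seqProb _ P h1, one_mul]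
        congr 1
        rw [Finset.sum_comm]
        simp only [Finset.mul_sum]
    _ ≤ ∑ j ∈ Finset.range N, (D + ∑ u : Fin n, b) := by
        refine Finset.sum_le_sum fun j hj => ?_
        have : ∑ u, ∑ q, seqProb (N * τ) P q * X u j q ≤ ∑ u : Fin n, b :=
          Finset.sum_le_sum fun u _ => hX u j (Finset.mem_range.1 hj)
        linarith
    _ = _ := by simp [mul_add]

/-- Theorem 4 of the paper: the algorithm `LCB⋆`, which commits to a maximizer `Z⋆` of
`DOAlg(c⁺, ·)`, has expected reward at least `E[r^PICO] − O(nT·√(log τ)/√τ)`. -/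
theorem lcb_star_approximates_pico :
    ∃ C : ℝ, 0 < C ∧
    ∀ (k n τ N : ℕ), 1 ≤ k → 1 ≤ n → 2 ≤ τ → 1 ≤ N →
    ∀ (P : Fin n → ℝ), (∀ u, 0 < P u) → (∑ u, P u = 1) →
    ∀ (μ : Fin n → Fin k → ℝ), (∀ u a, 0 ≤ μ u a ∧ μ u a ≤ 1) →
    ∀ (δ : Fin k → ℕ), (∀ a, δ a ≤ τ) →
    (∀ u : Fin n, 0 ≤ P u * (τ : ℝ) - Real.sqrt ((τ : ℝ) * Real.log (τ : ℝ))) →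
    ∀ γ : ℝ, 0 < γ → γ ≤ 1 / (k : ℝ) →
    (∑ a : Fin k, max ((δ a : ℝ)) (γ * (τ : ℝ)) ≤ (τ : ℝ)) →
    ∃ Zs : Finset (Fin k),
      (∀ Z : Finset (Fin k),
          DOAlgR (muPlus μ) δ (cplus P τ) Z ≤ DOAlgR (muPlus μ) δ (cplus P τ) Zs) ∧
      ∃ A : Alg k n (N * τ), PhaseInd τ A ∧ Committed τ δ Zs A ∧
        expReward (N * τ) τ P μ δ A
          ≥ picoReward k n (N * τ) τ P μ δ
            - C * (n : ℝ) * ((N * τ : ℕ) : ℝ) * Real.sqrt (Real.log (τ : ℝ)) /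
                Real.sqrt (τ : ℝ) := by
  refine ⟨10, by norm_num, ?_⟩
  intro k n τ N hk hn hτ hN P hP h1 μ hμ δ hδ hnn γ hγ hγk hsum
  have hτ0 : (0 : ℝ) < τ := by exact_mod_cast (by omega : 0 < τ)
  set R := Real.sqrt ((τ : ℝ) * Real.log τ) with hR
  have hR0 : 0 ≤ R := Real.sqrt_nonneg _
  let u0 : Fin n := ⟨0, hn⟩
  let a0 : Fin k := ⟨0, hk⟩
  -- facts on the aggregate
  have hcle : ∀ u, (cplusBase P τ u : ℝ) ≤ P u * τ - R := fun u => Nat.floor_le (hnn u)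
  have hcge : ∀ u, P u * τ - R - 1 ≤ (cplusBase P τ u : ℝ) := fun u => by
    have := Nat.lt_floor_add_one (P u * τ - R)
    unfold cplusBase
    linarith
  have hcsum : ∑ u, cplusBase P τ u ≤ τ := by
    have : ∑ u, (cplusBase P τ u : ℝ) ≤ τ := by
      calc _ ≤ ∑ u, P u * τ := Finset.sum_le_sum fun u _ => by have := hcle u; linarith
        _ = τ := by rw [← Finset.sum_mul, h1, one_mul]
    exact_mod_cast this
  have hδsum : ∀ Z : Finset (Fin k), ∑ a ∈ Z, δ a ≤ τ := by
    intro Z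
    refine le_trans (Finset.sum_le_sum_of_subset (Finset.subset_univ Z)) ?_
    have : ∑ a, (δ a : ℝ) ≤ τ :=
      le_trans (Finset.sum_le_sum fun a _ => le_max_left _ _) hsum
    exact_mod_cast this
  have hne : ∀ Z : Finset (Fin k), Z.Nonempty → (valSet (muPlus μ) δ (cplus P τ) Z).Nonempty :=
    fun Z hZ => valSet_nonempty _ _ _ (cplus_sum P τ hcsum) (Nat.succ_pos n) Z hZ (hδsum Z)
  have hmemS : ∀ Z : Finset (Fin k), Z.Nonempty →
      DOAlgR (muPlus μ) δ (cplus P τ) Z ∈ valSet (muPlus μ) δ (cplus P τ) Z :=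
    fun Z hZ => (hne Z hZ).csSup_mem (valSet_finite _ _ _ _)
  -- the maximizer
  obtain ⟨Zs, hZs, hmax⟩ := Finset.exists_max_image
    (Finset.univ.filter fun Z : Finset (Fin k) => Z.Nonempty)
    (fun Z => DOAlgR (muPlus μ) δ (cplus P τ) Z)
    ⟨{a0}, by simp⟩
  simp only [Finset.mem_filter, Finset.mem_univ, true_and] at hZs hmax
  obtain ⟨M, hM1, hM2, hM3, hM4⟩ := hmemS Zs hZs
  have hD0 : 0 ≤ DOAlgR (muPlus μ) δ (cplus P τ) Zs := by
    rw [hM4]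
    exact Finset.sum_nonneg fun u _ => Finset.sum_nonneg fun a _ =>
      mul_nonneg (Nat.cast_nonneg _) (muPlus_bounds μ hμ u a).1
  have hDτ : DOAlgR (muPlus μ) δ (cplus P τ) Zs ≤ τ := by
    rw [hM4]
    calc _ ≤ ∑ u, ∑ a, (M u a : ℝ) := Finset.sum_le_sum fun u _ => Finset.sum_le_sum fun a _ =>
          mul_le_of_le_one_right (Nat.cast_nonneg _) (muPlus_bounds μ hμ u a).2
      _ = τ := by
          have : ∑ u, ∑ a, M u a = τ := by
            simp only [hM1]; exact cplus_sum P τ hcsum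
          exact_mod_cast this
  have hmax' : ∀ Z : Finset (Fin k),
      DOAlgR (muPlus μ) δ (cplus P τ) Z ≤ DOAlgR (muPlus μ) δ (cplus P τ) Zs := by
    intro Z
    rcases Z.eq_empty_or_nonempty with rfl | hZ
    · have : valSet (muPlus μ) δ (cplus P τ) ∅ = ∅ := by
        rw [Set.eq_empty_iff_forall_notMem]
        rintro r ⟨Mx, hx1, hx2, -, -⟩
        have h3 : ∑ u, ∑ a, Mx u a = 0 :=
          Finset.sum_eq_zero fun u _ => Finset.sum_eq_zero fun a _ => hx2 u a (by simp)
        simp only [hx1, cplus_sum P τ hcsum] at h3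
        omega
      have h0 : DOAlgR (muPlus μ) δ (cplus P τ) ∅ = 0 := by
        change sSup (valSet (muPlus μ) δ (cplus P τ) ∅) = 0
        rw [this, Real.sSup_empty]
      rw [h0]; exact hD0
    · exact hmax Z hZ
  refine ⟨Zs, hmax', ?_⟩
  obtain ⟨z0, hz0⟩ := hZs
  choose L hL1 hL2 using fun x => row_seq (cplus P τ x) (M x) (hM1 x) Zs (hM2 x) z0 hz0
  set D := DOAlgR (muPlus μ) δ (cplus P τ) Zs with hD
  have hτpos : 0 < τ := by omega
  have hcom := lcbFun_committed (N := N) τ hτpos δ Zs L hL1 (hδsum Zs) (cplusBase P τ) u0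
  have hpi := lcbFun_phaseInd (N := N) τ δ Zs L (cplusBase P τ) u0
  set A : Alg k n (N * τ) :=
    ⟨lcbFun (N := N) τ δ Zs L (cplusBase P τ) u0, lcbFun_causal τ δ Zs L (cplusBase P τ) u0⟩ with hA
  refine ⟨A, hpi, hcom, ?_⟩
  -- lower bound
  have hlow : (N : ℝ) * (D - τ * (n * (1 / Real.sqrt τ))) ≤ expReward (N * τ) τ P μ δ A := by
    refine expReward_ge P hP h1 μ δ A D _ τ hτ0.le
      (fun u j q => if dev N τ P u j q ≤ -R then 1 else 0) ?_
      (fun u j hj => tail_dev N τ hτ P hP h1 u j hj)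
    intro q
    rw [seqReward_committed hτpos μ δ Zs A hcom q u0 a0]
    refine Finset.sum_le_sum fun j hj => ?_
    have hj := Finset.mem_range.1 hj
    by_cases hg : ∀ u, cplusBase P τ u ≤ Nat.count (fun s => seg u0 q j s = u) τ
    · have hlp := lower_phase P μ hμ δ Zs M hM3 L hL2 (seg u0 q j) hg
      rw [← hM4] at hlp
      have hX : (0 : ℝ) ≤ ∑ u : Fin n, (if dev N τ P u j q ≤ -R then (1 : ℝ) else 0) :=
        Finset.sum_nonneg fun u _ => by split_ifs <;> norm_num
      have hX2 := mul_nonneg hτ0.le hX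
      have e : ∑ s ∈ Finset.range τ, μ (seg u0 q j s) (seg a0 (A.1 q) j s)
          = ∑ s ∈ Finset.range τ, μ (seg u0 q j s)
            (corr τ δ Zs (pref L (cplusBase P τ) (seg u0 q j)) s) := by
        refine Finset.sum_congr rfl fun s hs => ?_
        have hs := Finset.mem_range.1 hs
        rw [seg_eq a0 _ _ _ (idx_lt hj hs)]
        exact congrArg _ (lcbFun_idx τ δ Zs L (cplusBase P τ) u0 q j s hs _)
      rw [e]
      linarith
    · push Not at hg
      obtain ⟨u, hu⟩ := hg
      have hdev : dev N τ P u j q ≤ -R := by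
        rw [dev_eq N τ P u j hj q u0]
        have := hcle u
        have h2 : (Nat.count (fun s => seg u0 q j s = u) τ : ℝ) ≤ cplusBase P τ u := by
          exact_mod_cast hu.le
        linarith
      have hX : (1 : ℝ) ≤ ∑ u : Fin n, (if dev N τ P u j q ≤ -R then (1 : ℝ) else 0) := by
        have := Finset.single_le_sum (s := Finset.univ)
          (f := fun u : Fin n => (if dev N τ P u j q ≤ -R then (1 : ℝ) else 0))
          (fun u _ => by split_ifs <;> norm_num) (Finset.mem_univ u)
        simpa only [hdev, if_true] using this
      have h0 : 0 ≤ ∑ s ∈ Finset.range τ, μ (seg u0 q j s) (seg a0 (A.1 q) j s) :=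
        Finset.sum_nonneg fun s _ => (hμ _ _).1
      nlinarith
  -- upper bound
  have hup : picoReward k n (N * τ) τ P μ δ ≤ N * (D + n * (2 * Real.sqrt τ + (R + 1))) := by
    unfold picoReward
    have : Nonempty {A : Alg k n (N * τ) // PhaseInd τ A ∧ ∃ Z, Committed τ δ Z A} :=
      ⟨⟨A, hpi, Zs, hcom⟩⟩
    refine ciSup_le ?_
    rintro ⟨B, -, Z, hB⟩
    refine expReward_le P hP h1 μ δ B D _ (fun u j q => max (dev N τ P u j q) 0 + (R + 1)) ?_ ?_
    · intro q
      rw [seqReward_committed hτpos μ δ Z B hB q u0 a0]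
      refine Finset.sum_le_sum fun j hj => ?_
      have hj := Finset.mem_range.1 hj
      have hphase := upper_phase P μ hμ δ hcsum Z (seg u0 q j) (seg a0 (B.1 q) j)
        (fun s hs => by rw [seg_eq _ _ _ _ (idx_lt hj hs)]; exact (hB q).1 _)
        (fun a ha => by
          rw [← pulls_eq (B.1 q) hj a (seg a0 (B.1 q) j)
            (fun s hs hh => (seg_eq _ _ _ _ hh).symm)]
          exact (hB q).2 j (Nat.mul_le_mul_right _ hj) a ha)
      have hcmp : ∑ u, (((Nat.count (fun s => seg u0 q j s = u) τ - cplusBase P τ u : ℕ)) : ℝ)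
          ≤ ∑ u, (max (dev N τ P u j q) 0 + (R + 1)) := by
        refine Finset.sum_le_sum fun u _ => ?_
        have hm0 := le_max_right (dev N τ P u j q) 0
        have hm1 := le_max_left (dev N τ P u j q) 0
        rcases le_total (Nat.count (fun s => seg u0 q j s = u) τ) (cplusBase P τ u) with hle | hle
        · rw [Nat.sub_eq_zero_of_le hle]
          push_cast
          linarith
        · rw [Nat.cast_sub hle]
          have := hcge u
          rw [dev_eq N τ P u j hj q u0] at hm1 ⊢
          linarith
      have := hmax' Z
      linarith
    · intro u j hj
      simp only [mul_add, Finset.sum_add_distrib, ← Finset.sum_mul, sum_seqProb _ P h1, one_mul]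
      have := pos_dev N τ hτ P hP h1 u j hj
      linarith
  -- arithmetic
  have hs0 : 0 < Real.sqrt τ := Real.sqrt_pos.2 hτ0
  have hss : Real.sqrt τ * Real.sqrt τ = τ := Real.mul_self_sqrt hτ0.le
  have hlog : (1 / 4 : ℝ) ≤ Real.log τ := by
    have h2 := Real.log_two_gt_d9
    have : Real.log 2 ≤ Real.log τ := Real.log_le_log (by norm_num) (by exact_mod_cast hτ)
    linarith
  have hsl : (1 / 2 : ℝ) ≤ Real.sqrt (Real.log τ) :=
    Real.le_sqrt_of_sq_le (by linarith)
  have hs1 : 1 ≤ Real.sqrt τ := Real.one_le_sqrt.2 (by exact_mod_cast hτpos)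
  have hRe : R = Real.sqrt τ * Real.sqrt (Real.log τ) := Real.sqrt_mul hτ0.le _
  have e1 : (τ : ℝ) * (n * (1 / Real.sqrt τ)) = n * Real.sqrt τ := by
    field_simp
    linarith
  have e2 : 10 * (n : ℝ) * ((N * τ : ℕ) : ℝ) * Real.sqrt (Real.log τ) / Real.sqrt τ
      = N * (n * (10 * R)) := by
    rw [hRe]
    push_cast
    field_simp
    rw [sq, hss]
  rw [e1] at hlow
  rw [e2]
  have hsR : Real.sqrt τ ≤ 2 * R := by rw [hRe]; nlinarith
  have hkey : (n : ℝ) * (2 * Real.sqrt τ + (R + 1)) + n * Real.sqrt τ ≤ n * (10 * R) := by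
    rw [← mul_add]
    exact mul_le_mul_of_nonneg_left (by linarith) (Nat.cast_nonneg _)
  have hfin := mul_le_mul_of_nonneg_left hkey (Nat.cast_nonneg (α := ℝ) N)
  have hh : (N : ℝ) * (D + n * (2 * Real.sqrt τ + (R + 1))) =
      N * (D - n * Real.sqrt τ) + N * (n * (2 * Real.sqrt τ + (R + 1)) + n * Real.sqrt τ) := by ring
  linarith

end ExposureBandits
end

section
/- There exist a constant c > 0 and two instances I₁, I₂ of the bandit-with-exposure model that agree in all parameters (n = 2, k = 2, P = (0.7, 0.3), μ with μ_{1,1} = μ_{2,2} = 1 and μ_{1,2} = μ_{2,1} = 0) except their exposure thresholds (δ¹ = (0, ⌈0.3τ⌉) versus δ² = (0, ⌈0.4τ⌉)), such that for all sufficiently large T (a multiple of τ, with τ sufficiently large) every algorithm A that is not given the thresholds as input — equivalently, any single algorithm run on both instances — satisfies max( E[R^A on I₁], E[R^A on I₂] ) ≥ c·T. -/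
open scoped BigOperators Classical

namespace ExposureBandits

/-- A (deterministic) learning algorithm: the arm pulled at round `t` may depend only on the
types observed in rounds `1,…,t` and on the realized utilities observed in rounds `1,…,t−1`. -/
def LCausal {k n T : ℕ} (B : (Fin T → Fin n) → (Fin T → ℝ) → Fin T → Fin k) : Prop :=
  ∀ (q q' : Fin T → Fin n) (v v' : Fin T → ℝ) (t : Fin T),
    (∀ s : Fin T, s ≤ t → q s = q' s) → (∀ s : Fin T, s < t → v s = v' s) →
    B q v t = B q' v' t

abbrev LAlg (k n T : ℕ) := {B : (Fin T → Fin n) → (Fin T → ℝ) → Fin T → Fin k // LCausal B}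

/-- `D` is a valid family of (finitely supported) reward distributions with support `V ⊆ [0,1]`
and means `μ`. -/
def ValidD {k n : ℕ} (μ : Fin n → Fin k → ℝ) (V : Finset ℝ)
    (D : Fin n → Fin k → ℝ → ℝ) : Prop :=
  (∀ x ∈ V, 0 ≤ x ∧ x ≤ 1) ∧
  ∀ u a, (∀ x, 0 ≤ D u a x) ∧ (∀ x, x ∉ V → D u a x = 0) ∧
    (∑ x ∈ V, D u a x = 1) ∧ (∑ x ∈ V, D u a x * x = μ u a)

/-- Probability of the trajectory `(q, v)` (types and realized utilities) under the learning
algorithm `B`: unavailable arms yield the realized utility `0` almost surely. -/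
noncomputable def trajProb {k n : ℕ} (T τ : ℕ) (P : Fin n → ℝ) (δ : Fin k → ℕ)
    (D : Fin n → Fin k → ℝ → ℝ) (B : LAlg k n T)
    (q : Fin T → Fin n) (v : Fin T → ℝ) : ℝ :=
  ∏ t : Fin T,
    P (q t) *
      (if availableAt T τ δ (B.1 q v) t (B.1 q v t) then D (q t) (B.1 q v t) (v t)
       else if v t = 0 then 1 else 0)

/-- Expected reward of the learning algorithm `B`. -/
noncomputable def expRewardL {k n : ℕ} (T τ : ℕ) (P : Fin n → ℝ) (μ : Fin n → Fin k → ℝ)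
    (δ : Fin k → ℕ) (D : Fin n → Fin k → ℝ → ℝ) (V : Finset ℝ) (B : LAlg k n T) : ℝ :=
  ∑ q : Fin T → Fin n,
    ∑ v ∈ Fintype.piFinset (fun _ : Fin T => insert (0 : ℝ) V),
      trajProb T τ P δ D B q v * seqReward T τ μ δ (B.1 q v) q

/-- The optimal expected reward on the instance: the value of the benchmark `OPT`, which has
full knowledge of the instance. -/
noncomputable def optRewardL (k n T τ : ℕ) (P : Fin n → ℝ) (μ : Fin n → Fin k → ℝ)
    (δ : Fin k → ℕ) (D : Fin n → Fin k → ℝ → ℝ) (V : Finset ℝ) : ℝ :=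
  ⨆ B : LAlg k n T, expRewardL T τ P μ δ D V B


/-- The arrival distribution of Proposition 7 of the paper. -/
noncomputable def P11 : Fin 2 → ℝ := ![0.7, 0.3]

/-- The utility matrix of Proposition 7 of the paper. -/
noncomputable def mu11 : Fin 2 → Fin 2 → ℝ := ![![1, 0], ![0, 1]]

/-- Exposure thresholds `δ¹ = (0, ⌈0.3τ⌉)`. -/
noncomputable def delta1 (τ : ℕ) : Fin 2 → ℕ := ![0, ⌈(0.3 : ℝ) * (τ : ℝ)⌉₊]

/-- Exposure thresholds `δ² = (0, ⌈0.4τ⌉)`. -/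
noncomputable def delta2 (τ : ℕ) : Fin 2 → ℕ := ![0, ⌈(0.4 : ℝ) * (τ : ℝ)⌉₊]

theorem mu11_eq (u a : Fin 2) : mu11 u a = if u = a then 1 else 0 := by
  fin_cases u <;> fin_cases a <;> simp [mu11]

theorem D_eq {V : Finset ℝ} {D : Fin 2 → Fin 2 → ℝ → ℝ} (h : ValidD mu11 V D) (u a : Fin 2) :
    mu11 u a ∈ V ∧ ∀ x, D u a x = if x = mu11 u a then 1 else 0 := by
  obtain ⟨hV, h⟩ := h
  obtain ⟨h0, hz, h1, hm⟩ := h u a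
  have key : ∀ x, x ≠ mu11 u a → D u a x = 0 := by
    intro x hx
    by_cases hxV : x ∈ V
    swap
    · exact hz x hxV
    rw [mu11_eq] at hx hm
    split_ifs at hx hm with hua
    · have hs : ∑ y ∈ V, D u a y * (1 - y) = 0 := by
        simp only [mul_sub, mul_one, Finset.sum_sub_distrib]
        linarith
      rw [Finset.sum_eq_zero_iff_of_nonneg
        (fun y hy => mul_nonneg (h0 y) (by linarith [(hV y hy).2]))] at hs
      rcases mul_eq_zero.1 (hs x hxV) with h | h
      · exact h
      · exact absurd (by linarith) hx
    · rw [Finset.sum_eq_zero_iff_of_nonneg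
        (fun y hy => mul_nonneg (h0 y) (hV y hy).1)] at hm
      rcases mul_eq_zero.1 (hm x hxV) with h | h
      · exact h
      · exact absurd h hx
  have hmem : mu11 u a ∈ V := by
    by_contra hn
    have : ∑ x ∈ V, D u a x = 0 := Finset.sum_eq_zero (fun x hx => key x (by
      rintro rfl; exact hn hx))
    linarith
  refine ⟨hmem, fun x => ?_⟩
  split_ifs with hx
  · rw [Finset.sum_eq_single_of_mem _ hmem (fun y _ hy => key y hy)] at h1
    rw [hx, h1]
  · exact key x hx

theorem fixpoint_exists {T : ℕ} (F : (Fin T → ℝ) → Fin T → ℝ)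
    (hF : ∀ v v' t, (∀ s, s < t → v s = v' s) → F v t = F v' t) :
    ∃ v, F v = v := by
  have h : ∀ n : ℕ, ∀ t : Fin T, (t : ℕ) < n → F^[n + 1] 0 t = F^[n] 0 t := by
    intro n
    induction n with
    | zero => intro t ht; omega
    | succ n ih =>
      intro t ht
      rw [Function.iterate_succ_apply' F (n + 1), Function.iterate_succ_apply' F n]
      apply hF
      intro s hs
      have hs' : (s : ℕ) < t := hs
      rw [← Function.iterate_succ_apply' F n]
      exact ih s (by omega)
  refine ⟨F^[T] 0, ?_⟩
  funext t
  rw [← Function.iterate_succ_apply' F]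
  exact h T t t.2

theorem pullsInPhase_congr {k T τ : ℕ} {p p' : Fin T → Fin k} {j : ℕ} (a : Fin k)
    (h : ∀ s : Fin T, (s : ℕ) < (j + 1) * τ → p s = p' s) :
    pullsInPhase T τ p j a = pullsInPhase T τ p' j a := by
  unfold pullsInPhase
  congr 1
  apply Finset.filter_congr
  intro s _
  constructor
  · rintro ⟨h1, h2, h3⟩; exact ⟨h1, h2, by rw [← h s h2]; exact h3⟩
  · rintro ⟨h1, h2, h3⟩; exact ⟨h1, h2, by rw [h s h2]; exact h3⟩

theorem availableAt_congr {k T τ : ℕ} {δ : Fin k → ℕ} {p p' : Fin T → Fin k} {t : Fin T}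
    (a : Fin k) (h : ∀ s, s < t → p s = p' s) :
    availableAt T τ δ p t a ↔ availableAt T τ δ p' t a := by
  unfold availableAt
  refine forall_congr' fun j => forall_congr' fun hj => ?_
  rw [pullsInPhase_congr a (fun s hs => h s (show (s : ℕ) < t by omega))]

/-- The feedback map. -/
noncomputable def fb {T : ℕ} (τ : ℕ) (δ : Fin 2 → ℕ) (B : LAlg 2 2 T) (q : Fin T → Fin 2)
    (v : Fin T → ℝ) (t : Fin T) : ℝ :=
  if availableAt T τ δ (B.1 q v) t (B.1 q v t) then mu11 (q t) (B.1 q v t) else 0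

theorem fb_congr {T : ℕ} (τ : ℕ) (δ : Fin 2 → ℕ) (B : LAlg 2 2 T) {q q' : Fin T → Fin 2}
    {v v' : Fin T → ℝ} {t : Fin T} (hq : ∀ s, s ≤ t → q s = q' s)
    (hv : ∀ s, s < t → v s = v' s) : fb τ δ B q v t = fb τ δ B q' v' t := by
  have hp : ∀ s, s ≤ t → B.1 q v s = B.1 q' v' s := fun s hs =>
    B.2 q q' v v' s (fun r hr => hq r (hr.trans hs)) (fun r hr => hv r (lt_of_lt_of_le hr hs))
  unfold fb
  rw [hp t le_rfl, hq t le_rfl]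
  simp only [availableAt_congr (τ := τ) (δ := δ) (B.1 q' v' t) (fun s hs => hp s (le_of_lt hs))]

theorem vs_exists {T : ℕ} (τ : ℕ) (δ : Fin 2 → ℕ) (B : LAlg 2 2 T) (q : Fin T → Fin 2) :
    ∃ v, fb τ δ B q v = v :=
  fixpoint_exists _ (fun _ _ _ h => fb_congr τ δ B (fun _ _ => rfl) h)

/-- The realized utilities. -/
noncomputable def vs {T : ℕ} (τ : ℕ) (δ : Fin 2 → ℕ) (B : LAlg 2 2 T) (q : Fin T → Fin 2) :
    Fin T → ℝ := (vs_exists τ δ B q).choose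

theorem vs_spec {T : ℕ} (τ : ℕ) (δ : Fin 2 → ℕ) (B : LAlg 2 2 T) (q : Fin T → Fin 2) :
    fb τ δ B q (vs τ δ B q) = vs τ δ B q := (vs_exists τ δ B q).choose_spec

/-- Realized pulls. -/
noncomputable def pl {T : ℕ} (τ : ℕ) (δ : Fin 2 → ℕ) (B : LAlg 2 2 T) (q : Fin T → Fin 2) :
    Fin T → Fin 2 := B.1 q (vs τ δ B q)

theorem fix_congr {T : ℕ} (τ : ℕ) (δ : Fin 2 → ℕ) (B : LAlg 2 2 T) {q q' : Fin T → Fin 2}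
    {v v' : Fin T → ℝ} (hv : fb τ δ B q v = v) (hv' : fb τ δ B q' v' = v') (t : Fin T)
    (hq : ∀ s, s ≤ t → q s = q' s) : v t = v' t := by
  induction t using WellFoundedLT.induction with
  | ind t ih =>
    rw [← hv, ← hv']
    exact fb_congr τ δ B hq (fun s hs => ih s hs (fun r hr => hq r (hr.trans hs.le)))

theorem pl_congr {T : ℕ} (τ : ℕ) (δ : Fin 2 → ℕ) (B : LAlg 2 2 T) {q q' : Fin T → Fin 2}
    (t : Fin T) (hq : ∀ s, s ≤ t → q s = q' s) : pl τ δ B q t = pl τ δ B q' t :=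
  B.2 _ _ _ _ t hq (fun s hs => fix_congr τ δ B (vs_spec τ δ B q) (vs_spec τ δ B q') s
    (fun r hr => hq r (hr.trans hs.le)))

/-- Expectation over arrival sequences. -/
noncomputable def Ex {T : ℕ} (f : (Fin T → Fin 2) → ℝ) : ℝ :=
  ∑ q : Fin T → Fin 2, (∏ t, P11 (q t)) * f q

theorem P11_nonneg (u : Fin 2) : 0 ≤ P11 u := by
  fin_cases u <;> simp [P11] <;> norm_num

theorem Ex_const {T : ℕ} (c : ℝ) : Ex (T := T) (fun _ => c) = c := by
  unfold Ex
  rw [← Finset.sum_mul]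
  have := Finset.prod_univ_sum (fun _ : Fin T => (Finset.univ : Finset (Fin 2)))
    (fun _ u => P11 u)
  rw [Fintype.piFinset_univ] at this
  rw [← this]
  have h1 : ∑ u, P11 u = 1 := by
    rw [Fin.sum_univ_two]; simp [P11]; norm_num
  simp [h1]

theorem Ex_add {T : ℕ} (f g : (Fin T → Fin 2) → ℝ) :
    Ex (fun q => f q + g q) = Ex f + Ex g := by
  unfold Ex; rw [← Finset.sum_add_distrib]; simp only [mul_add]

theorem Ex_sub {T : ℕ} (f g : (Fin T → Fin 2) → ℝ) :
    Ex (fun q => f q - g q) = Ex f - Ex g := by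
  unfold Ex; rw [← Finset.sum_sub_distrib]; simp only [mul_sub]

theorem Ex_smul {T : ℕ} (c : ℝ) (f : (Fin T → Fin 2) → ℝ) :
    Ex (fun q => c * f q) = c * Ex f := by
  unfold Ex; rw [Finset.mul_sum]; congr 1; funext q; ring

theorem Ex_sum {T : ℕ} {ι : Type*} (s : Finset ι) (f : ι → (Fin T → Fin 2) → ℝ) :
    Ex (fun q => ∑ i ∈ s, f i q) = ∑ i ∈ s, Ex (f i) := by
  unfold Ex; rw [Finset.sum_comm]; simp only [Finset.mul_sum]

theorem Ex_mono {T : ℕ} {f g : (Fin T → Fin 2) → ℝ} (h : ∀ q, f q ≤ g q) : Ex f ≤ Ex g :=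
  Finset.sum_le_sum fun q _ => mul_le_mul_of_nonneg_left (h q)
    (Finset.prod_nonneg fun _ _ => P11_nonneg _)

/-- Centered indicator of the first type. -/
noncomputable def zz (u : Fin 2) : ℝ := ![0.3, -0.7] u

theorem zz_eq (u : Fin 2) : zz u = (if u = 0 then 1 else 0) - 0.7 := by
  fin_cases u <;> simp [zz]; norm_num

theorem zz_sq (u : Fin 2) : zz u * zz u = 0.21 + (-0.4) * (1 * zz u) := by
  fin_cases u <;> simp [zz] <;> norm_num

theorem Ex_indep {T : ℕ} (t : Fin T) (h : (Fin T → Fin 2) → ℝ)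
    (hh : ∀ q x, h (Function.update q t x) = h q) :
    Ex (fun q => h q * zz (q t)) = 0 := by
  unfold Ex
  have hfl : ∀ u : Fin 2, 1 - (1 - u) = u := by decide
  refine Finset.sum_involution (fun q _ => Function.update q t (1 - q t)) ?_ ?_ ?_ ?_
  · intro q _
    simp only [hh, Function.update_self]
    rw [← Finset.mul_prod_erase _ _ (Finset.mem_univ t),
      ← Finset.mul_prod_erase _ _ (Finset.mem_univ t), Function.update_self]
    have : ∏ s ∈ Finset.univ.erase t, P11 (Function.update q t (1 - q t) s)
        = ∏ s ∈ Finset.univ.erase t, P11 (q s) := by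
      apply Finset.prod_congr rfl
      intro s hs
      rw [Function.update_of_ne (Finset.ne_of_mem_erase hs)]
    rw [this]
    have hz : P11 (q t) * zz (q t) + P11 (1 - q t) * zz (1 - q t) = 0 := by
      generalize q t = u
      fin_cases u <;> simp [P11, zz] <;> norm_num
    linear_combination (∏ s ∈ Finset.univ.erase t, P11 (q s)) * h q * hz
  · intro q _ _ he
    have := congrFun he t
    rw [Function.update_self] at this
    generalize q t = u at this
    revert this; revert u; decide
  · intro q _; exact Finset.mem_univ _
  · intro q _
    simp [hfl]

theorem expRewardL_eq {T : ℕ} (τ : ℕ) (δ : Fin 2 → ℕ) {V : Finset ℝ}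
    {D : Fin 2 → Fin 2 → ℝ → ℝ} (hD : ValidD mu11 V D) (B : LAlg 2 2 T) :
    expRewardL T τ P11 mu11 δ D V B = Ex (fun q => seqReward T τ mu11 δ (pl τ δ B q) q) := by
  unfold expRewardL Ex
  apply Finset.sum_congr rfl
  intro q _
  have htp : ∀ v, trajProb T τ P11 δ D B q v =
      (∏ t, P11 (q t)) * if v = vs τ δ B q then 1 else 0 := by
    intro v
    unfold trajProb
    rw [Finset.prod_mul_distrib]
    congr 1
    have h1 : ∀ t, (if availableAt T τ δ (B.1 q v) t (B.1 q v t) then D (q t) (B.1 q v t) (v t)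
       else if v t = 0 then 1 else 0) = if v t = fb τ δ B q v t then (1:ℝ) else 0 := by
      intro t
      unfold fb
      by_cases ha : availableAt T τ δ (B.1 q v) t (B.1 q v t)
      · simp only [if_pos ha, (D_eq hD _ _).2]
      · simp only [if_neg ha]
    simp only [h1]
    rw [Finset.prod_ite_zero]
    have h2 : (∀ t ∈ Finset.univ, v t = fb τ δ B q v t) ↔ v = vs τ δ B q := by
      constructor
      · intro h
        funext t
        exact fix_congr τ δ B (funext fun t => (h t (Finset.mem_univ _)).symm)
          (vs_spec τ δ B q) t (fun _ _ => rfl)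
      · rintro rfl t _
        rw [vs_spec]
    simp only [Finset.mem_univ, true_imp_iff] at h2 ⊢
    simp [h2]
  simp only [htp]
  rw [Finset.sum_eq_single_of_mem (vs τ δ B q)]
  · simp [pl]
  · rw [Fintype.mem_piFinset]
    intro t
    rw [← vs_spec]
    unfold fb
    split_ifs
    · exact Finset.mem_insert_of_mem (D_eq hD _ _).1
    · exact Finset.mem_insert_self _ _
  · intro v _ hv
    simp [hv]

/-- Reward of one round. -/
noncomputable def rr {T : ℕ} (τ : ℕ) (δ : Fin 2 → ℕ) (p : Fin T → Fin 2) (q : Fin T → Fin 2)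
    (t : Fin T) : ℝ := if availableAt T τ δ p t (p t) then mu11 (q t) (p t) else 0

theorem rr_le_mu {T : ℕ} (τ : ℕ) (δ : Fin 2 → ℕ) (p q : Fin T → Fin 2) (t : Fin T) :
    rr τ δ p q t ≤ mu11 (q t) (p t) := by
  unfold rr
  have : 0 ≤ mu11 (q t) (p t) := by rw [mu11_eq]; split_ifs <;> norm_num
  split_ifs <;> linarith

theorem rr_le_one {T : ℕ} (τ : ℕ) (δ : Fin 2 → ℕ) (p q : Fin T → Fin 2) (t : Fin T) :
    rr τ δ p q t ≤ 1 := by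
  refine (rr_le_mu τ δ p q t).trans ?_
  rw [mu11_eq]; split_ifs <;> norm_num

theorem le_opt {T : ℕ} (τ : ℕ) (δ : Fin 2 → ℕ) {V : Finset ℝ}
    {D : Fin 2 → Fin 2 → ℝ → ℝ} (hD : ValidD mu11 V D) (B : LAlg 2 2 T) :
    expRewardL T τ P11 mu11 δ D V B ≤ optRewardL 2 2 T τ P11 mu11 δ D V := by
  unfold optRewardL
  refine le_ciSup (f := fun B => expRewardL T τ P11 mu11 δ D V B) ?_ B
  refine ⟨T, ?_⟩
  rintro _ ⟨B, rfl⟩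
  simp only
  rw [expRewardL_eq τ δ hD]
  refine (Ex_mono (g := fun _ => (T : ℝ)) fun q => ?_).trans_eq (Ex_const _)
  calc seqReward T τ mu11 δ (pl τ δ B q) q ≤ ∑ t : Fin T, (1:ℝ) :=
        Finset.sum_le_sum fun t _ => rr_le_one τ δ _ q t
    _ = T := by simp

/-- The rounds of phase `j`. -/
def ph (T τ j : ℕ) : Finset (Fin T) := Finset.univ.filter fun t => (t : ℕ) / τ = j

theorem mem_ph {T τ j : ℕ} {t : Fin T} : t ∈ ph T τ j ↔ (t : ℕ) / τ = j := by simp [ph]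

theorem card_ph {N τ j : ℕ} (hτ : 0 < τ) (hj : j < N) : (ph (N * τ) τ j).card = τ := by
  have : (ph (N * τ) τ j).card = (Finset.Ico (j * τ) ((j + 1) * τ)).card := by
    have hb : (j + 1) * τ ≤ N * τ := Nat.mul_le_mul_right _ hj
    refine Finset.card_bij (fun t _ => (t : ℕ)) ?_ ?_ ?_
    · intro t ht
      rw [mem_ph, Nat.div_eq_iff hτ] at ht
      rw [Finset.mem_Ico, add_mul]; omega
    · intro a _ b _ h; exact Fin.ext h
    · intro b hb'
      rw [Finset.mem_Ico] at hb'
      refine ⟨⟨b, by omega⟩, ?_, rfl⟩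
      rw [mem_ph, Nat.div_eq_iff hτ]
      rw [add_mul] at hb'
      simp only; omega
  rw [this, Nat.card_Ico, add_mul]; omega

theorem sum_ph {N τ : ℕ} (hτ : 0 < τ) (f : Fin (N * τ) → ℝ) :
    ∑ t, f t = ∑ j ∈ Finset.range N, ∑ t ∈ ph (N * τ) τ j, f t := by
  symm
  apply Finset.sum_fiberwise_of_maps_to
  intro t _
  rw [Finset.mem_range]
  exact (Nat.div_lt_iff_lt_mul hτ).2 t.2

theorem pullsInPhase_eq {T τ : ℕ} (hτ : 0 < τ) (p : Fin T → Fin 2) (j : ℕ) (a : Fin 2) :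
    pullsInPhase T τ p j a = ((ph T τ j).filter fun t => p t = a).card := by
  unfold pullsInPhase ph
  rw [Finset.filter_filter]
  congr 1
  apply Finset.filter_congr
  intro t _
  rw [Nat.div_eq_iff hτ, add_mul, ← and_assoc]
  refine and_congr_left fun _ => ?_
  omega

theorem pulls_add {N τ j : ℕ} (hτ : 0 < τ) (hj : j < N) (p : Fin (N * τ) → Fin 2) :
    ((ph (N * τ) τ j).filter fun t => p t = 0).card + pullsInPhase (N * τ) τ p j 1 = τ := by
  rw [pullsInPhase_eq hτ]
  have h := Finset.card_filter_add_card_filter_not (s := ph (N * τ) τ j) (fun t => p t = 0)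
  rw [card_ph hτ hj] at h
  refine Eq.trans ?_ h
  congr 2
  apply Finset.filter_congr
  intro t _
  generalize p t = u
  revert u; decide

/-- All phases before `j` satisfied the constraint of the second arm. -/
def AV (T τ : ℕ) (δ : Fin 2 → ℕ) (p : Fin T → Fin 2) (j : ℕ) : Prop :=
  ∀ i, i < j → δ 1 ≤ pullsInPhase T τ p i 1

theorem avail_iff {T τ : ℕ} (hτ : 0 < τ) (δ : Fin 2 → ℕ) (p : Fin T → Fin 2) (t : Fin T) :
    availableAt T τ δ p t 1 ↔ AV T τ δ p ((t : ℕ) / τ) := by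
  unfold availableAt AV
  refine forall_congr' fun j => ?_
  rw [← Nat.succ_le_iff, Nat.le_div_iff_mul_le hτ]

theorem AV_anti {T τ : ℕ} {δ : Fin 2 → ℕ} {p : Fin T → Fin 2} {i j : ℕ} (h : i ≤ j)
    (ha : AV T τ δ p j) : AV T τ δ p i := fun r hr => ha r (by omega)

theorem coupling {T τ : ℕ} (hτ : 0 < τ) {δ₁ δ₂ : Fin 2 → ℕ} (h0 : δ₁ 0 = 0) (h0' : δ₂ 0 = 0)
    (hle : δ₁ 1 ≤ δ₂ 1) (B : LAlg 2 2 T) (q : Fin T → Fin 2) (j : ℕ)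
    (hav : AV T τ δ₂ (pl τ δ₂ B q) j) (t : Fin T) (ht : (t : ℕ) / τ ≤ j) :
    vs τ δ₁ B q t = vs τ δ₂ B q t ∧ pl τ δ₁ B q t = pl τ δ₂ B q t := by
  induction t using WellFoundedLT.induction with
  | ind t ih =>
    have ih' : ∀ s, s < t → vs τ δ₁ B q s = vs τ δ₂ B q s ∧ pl τ δ₁ B q s = pl τ δ₂ B q s :=
      fun s hs => ih s hs ((Nat.div_le_div_right (show (s : ℕ) ≤ t from hs.le)).trans ht)
    have hp : pl τ δ₁ B q t = pl τ δ₂ B q t :=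
      B.2 _ _ _ _ t (fun _ _ => rfl) (fun s hs => (ih' s hs).1)
    refine ⟨?_, hp⟩
    have a2 : ∀ a, availableAt T τ δ₂ (pl τ δ₂ B q) t a := by
      intro a
      by_cases ha : a = 0
      · subst ha; intro i _; rw [h0']; exact Nat.zero_le _
      · have ha : a = 1 := by revert a; decide
        subst ha
        rw [avail_iff hτ]; exact AV_anti ht hav
    have a1 : ∀ a, availableAt T τ δ₁ (pl τ δ₁ B q) t a := by
      intro a
      rw [availableAt_congr a (fun s hs => (ih' s hs).2)]
      intro i hi
      by_cases ha : a = 0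
      · subst ha; rw [h0]; exact Nat.zero_le _
      · have ha : a = 1 := by revert a; decide
        subst ha
        exact hle.trans (a2 1 i hi)
    rw [← vs_spec τ δ₁, ← vs_spec τ δ₂]
    have e1 : fb τ δ₁ B q (vs τ δ₁ B q) t = mu11 (q t) (pl τ δ₁ B q t) := if_pos (a1 _)
    have e2 : fb τ δ₂ B q (vs τ δ₂ B q) t = mu11 (q t) (pl τ δ₂ B q t) := if_pos (a2 _)
    rw [e1, e2, hp]

theorem phase_le {N τ j : ℕ} (hτ : 0 < τ) (hj : j < N) (δ δ' : Fin 2 → ℕ)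
    (p q : Fin (N * τ) → Fin 2) (hd : δ' 1 ≤ pullsInPhase (N * τ) τ p j 1) :
    ∑ t ∈ ph (N * τ) τ j, rr τ δ p q t ≤
      (τ - δ' 1 : ℝ) + ∑ t ∈ ph (N * τ) τ j, (0.3 - zz (q t)) := by
  have h1 : ∀ t ∈ ph (N * τ) τ j, rr τ δ p q t ≤
      (if p t = 0 then (1:ℝ) else 0) + (0.3 - zz (q t)) := by
    intro t _
    refine (rr_le_mu τ δ p q t).trans ?_
    rw [mu11_eq, zz_eq]
    generalize p t = a
    generalize q t = b
    fin_cases a <;> fin_cases b <;> norm_num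
  refine (Finset.sum_le_sum h1).trans ?_
  rw [Finset.sum_add_distrib, Finset.sum_boole]
  have h2 := pulls_add hτ hj p
  have h3 : ((((ph (N * τ) τ j).filter fun t => p t = 0).card : ℕ) : ℝ) + (δ' 1 : ℝ) ≤ τ := by
    have : ((ph (N * τ) τ j).filter fun t => p t = 0).card + δ' 1 ≤ τ := by omega
    exact_mod_cast this
  linarith

/-- Upper bound for the sum of the rewards on both instances. -/
theorem upper_pt {N τ : ℕ} (hτ : 0 < τ) {δ₁ δ₂ : Fin 2 → ℕ} (h0 : δ₁ 0 = 0) (h0' : δ₂ 0 = 0)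
    (hle : δ₁ 1 ≤ δ₂ 1) (h4 : (0.4 : ℝ) * τ ≤ δ₂ 1) (B : LAlg 2 2 (N * τ))
    (q : Fin (N * τ) → Fin 2) :
    seqReward (N * τ) τ mu11 δ₁ (pl τ δ₁ B q) q + seqReward (N * τ) τ mu11 δ₂ (pl τ δ₂ B q) q ≤
      0.8 * τ + ∑ t : Fin (N * τ), (1.8 +
        (1 - 3 * if AV (N * τ) τ δ₂ (pl τ δ₂ B q) ((t : ℕ) / τ) then (1 : ℝ) else 0) * zz (q t)) := by
  set p₁ := pl τ δ₁ B q with hp₁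
  set p₂ := pl τ δ₂ B q with hp₂
  change (∑ t, rr τ δ₁ p₁ q t) + (∑ t, rr τ δ₂ p₂ q t) ≤ _
  rw [sum_ph hτ, sum_ph hτ, sum_ph hτ, ← Finset.sum_add_distrib]
  set a : ℕ → ℝ := fun j => if AV (N * τ) τ δ₂ p₂ j then (1 : ℝ) else 0 with ha
  have htel : ∑ j ∈ Finset.range N, (0.8 * τ * (a j - a (j + 1))) ≤ 0.8 * τ := by
    rw [← Finset.mul_sum, Finset.sum_range_sub']
    have h1 : a 0 ≤ 1 := by simp only [ha]; split_ifs <;> norm_num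
    have h2 : 0 ≤ a N := by simp only [ha]; split_ifs <;> norm_num
    have : (0 : ℝ) ≤ τ := Nat.cast_nonneg _
    nlinarith
  refine le_trans ?_ (add_le_add_left htel _)
  rw [← Finset.sum_add_distrib]
  apply Finset.sum_le_sum
  intro j hj
  rw [Finset.mem_range] at hj
  have hc := card_ph hτ hj
  have hsum : ∑ t ∈ ph (N * τ) τ j, (1.8 +
      (1 - 3 * if AV (N * τ) τ δ₂ p₂ ((t : ℕ) / τ) then (1 : ℝ) else 0) * zz (q t)) =
      1.8 * τ + (1 - 3 * a j) * ∑ t ∈ ph (N * τ) τ j, zz (q t) := by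
    rw [Finset.sum_add_distrib, Finset.sum_const, hc, Finset.mul_sum, nsmul_eq_mul, mul_comm]
    congr 1
    apply Finset.sum_congr rfl
    intro t ht
    rw [mem_ph.1 ht]
  rw [hsum]
  have hone : ∀ δ p, ∑ t ∈ ph (N * τ) τ j, rr τ δ p q t ≤ τ := by
    intro δ p
    refine (Finset.sum_le_sum fun t _ => rr_le_one τ δ p q t).trans ?_
    simp [hc]
  have hZ : ∑ t ∈ ph (N * τ) τ j, (0.3 - zz (q t)) =
      0.3 * τ - ∑ t ∈ ph (N * τ) τ j, zz (q t) := by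
    rw [Finset.sum_sub_distrib, Finset.sum_const, hc, nsmul_eq_mul, mul_comm]
  have hZ' : ∑ t ∈ ph (N * τ) τ j, (0.7 + zz (q t)) =
      0.7 * τ + ∑ t ∈ ph (N * τ) τ j, zz (q t) := by
    rw [Finset.sum_add_distrib, Finset.sum_const, hc, nsmul_eq_mul, mul_comm]
  have hZ0 : ∑ t ∈ ph (N * τ) τ j, zz (q t) ≤ 0.3 * τ := by
    have : 0 ≤ ∑ t ∈ ph (N * τ) τ j, (0.3 - zz (q t)) := Finset.sum_nonneg fun t _ => by
      rw [zz_eq]; split_ifs <;> norm_num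
    linarith
  have hτ0 : (0 : ℝ) ≤ τ := Nat.cast_nonneg _
  by_cases h1 : AV (N * τ) τ δ₂ p₂ j
  · have haj : a j = 1 := if_pos h1
    by_cases h2 : AV (N * τ) τ δ₂ p₂ (j + 1)
    · have haj' : a (j + 1) = 1 := if_pos h2
      have hpull := h2 j (Nat.lt_succ_self j)
      have hpull1 : δ₂ 1 ≤ pullsInPhase (N * τ) τ p₁ j 1 := by
        rw [pullsInPhase_congr (p' := p₂) 1]
        · exact hpull
        · intro s hs
          refine (coupling hτ h0 h0' hle B q j h1 s ?_).2
          have := (Nat.div_lt_iff_lt_mul hτ).2 hs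
          omega
      have b1 := phase_le hτ hj δ₁ δ₂ p₁ q hpull1
      have b2 := phase_le hτ hj δ₂ δ₂ p₂ q hpull
      rw [haj, haj']
      linarith
    · have haj' : a (j + 1) = 0 := if_neg h2
      have b1 := hone δ₁ p₁
      have b2 := hone δ₂ p₂
      rw [haj, haj']
      linarith
  · have haj : a j = 0 := if_neg h1
    have haj' : a (j + 1) = 0 := if_neg fun h => h1 (AV_anti (Nat.le_succ j) h)
    have b1 := hone δ₁ p₁
    have b2 : ∑ t ∈ ph (N * τ) τ j, rr τ δ₂ p₂ q t ≤
        ∑ t ∈ ph (N * τ) τ j, (0.7 + zz (q t)) := by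
      apply Finset.sum_le_sum
      intro t ht
      by_cases hpt : p₂ t = 0
      · refine (rr_le_mu τ δ₂ p₂ q t).trans ?_
        rw [hpt, mu11_eq, zz_eq]
        linarith
      · have hpt : p₂ t = 1 := by
          generalize p₂ t = u at hpt
          revert u; decide
        have : rr τ δ₂ p₂ q t = 0 := by
          unfold rr
          rw [if_neg]
          rw [hpt, avail_iff hτ, mem_ph.1 ht]
          exact h1
        rw [this, zz_eq]
        split_ifs <;> norm_num
    rw [haj, haj']
    linarith

theorem upper {N τ : ℕ} (hτ : 0 < τ) {δ₁ δ₂ : Fin 2 → ℕ} (h0 : δ₁ 0 = 0) (h0' : δ₂ 0 = 0)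
    (hle : δ₁ 1 ≤ δ₂ 1) (h4 : (0.4 : ℝ) * τ ≤ δ₂ 1) {V : Finset ℝ}
    {D : Fin 2 → Fin 2 → ℝ → ℝ} (hD : ValidD mu11 V D) (B : LAlg 2 2 (N * τ)) :
    expRewardL (N * τ) τ P11 mu11 δ₁ D V B + expRewardL (N * τ) τ P11 mu11 δ₂ D V B ≤
      0.8 * τ + 1.8 * (N * τ : ℕ) := by
  rw [expRewardL_eq τ δ₁ hD, expRewardL_eq τ δ₂ hD, ← Ex_add]
  refine (Ex_mono fun q => upper_pt hτ h0 h0' hle h4 B q).trans ?_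
  rw [Ex_add, Ex_const, Ex_sum]
  have : ∀ t : Fin (N * τ), Ex (fun q => (1.8 : ℝ) +
        (1 - 3 * if AV (N * τ) τ δ₂ (pl τ δ₂ B q) ((t : ℕ) / τ) then (1 : ℝ) else 0) * zz (q t))
        = 1.8 := by
    intro t
    rw [Ex_add, Ex_const, Ex_indep t (fun q =>
      (1 - 3 * if AV (N * τ) τ δ₂ (pl τ δ₂ B q) ((t : ℕ) / τ) then (1 : ℝ) else 0)), add_zero]
    intro q x
    simp only [← avail_iff hτ]
    have := availableAt_congr (τ := τ) (δ := δ₂) (p := pl τ δ₂ B (Function.update q t x))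
      (p' := pl τ δ₂ B q) (t := t) 1 (fun s hs => pl_congr τ δ₂ B s (fun r hr =>
        Function.update_of_ne (lt_of_le_of_lt hr hs).ne _ _))
    simp only [this]
  simp only [this]
  simp
  linarith

/-- Number of type-0 users up to round `t` in its phase. -/
noncomputable def rk {T : ℕ} (τ : ℕ) (q : Fin T → Fin 2) (t : Fin T) : ℕ :=
  ((ph T τ ((t : ℕ) / τ)).filter fun s => q s = 0 ∧ s ≤ t).card

theorem rk_congr {T : ℕ} (τ : ℕ) {q q' : Fin T → Fin 2} (t : Fin T)
    (h : ∀ s, s ≤ t → q s = q' s) : rk τ q t = rk τ q' t := by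
  unfold rk
  congr 1
  apply Finset.filter_congr
  intro s _
  constructor
  · rintro ⟨h1, h2⟩; exact ⟨by rw [← h s h2]; exact h1, h2⟩
  · rintro ⟨h1, h2⟩; exact ⟨by rw [h s h2]; exact h1, h2⟩

theorem rk_pos {T : ℕ} (τ : ℕ) (q : Fin T → Fin 2) (t : Fin T) (h : q t = 0) :
    1 ≤ rk τ q t := by
  apply Finset.card_pos.2
  exact ⟨t, by simp [mem_ph, h]⟩

theorem rk_le {T : ℕ} (τ : ℕ) (q : Fin T → Fin 2) (t : Fin T) :
    rk τ q t ≤ ((ph T τ ((t : ℕ) / τ)).filter fun s => q s = 0).card := by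
  apply Finset.card_le_card
  intro s
  simp only [Finset.mem_filter]
  tauto

theorem rk_lt {T : ℕ} (τ : ℕ) (q : Fin T → Fin 2) {s t : Fin T} (hp : (s : ℕ) / τ = (t : ℕ) / τ)
    (hst : s < t) (ht : q t = 0) : rk τ q s < rk τ q t := by
  apply Finset.card_lt_card
  rw [Finset.ssubset_iff_of_subset]
  · refine ⟨t, by simp [mem_ph, ht], ?_⟩
    simp [hst]
  · intro r
    simp only [Finset.mem_filter, mem_ph]
    rintro ⟨h1, h2, h3⟩
    exact ⟨h1.trans hp, h2, h3.trans hst.le⟩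

theorem rk_injOn {T : ℕ} (τ j : ℕ) (q : Fin T → Fin 2) :
    Set.InjOn (rk τ q) {t | (t : ℕ) / τ = j ∧ q t = 0} := by
  rintro s ⟨hs, hs0⟩ t ⟨ht, ht0⟩ h
  rcases lt_trichotomy s t with hl | hl | hl
  · exact absurd h (rk_lt τ q (hs.trans ht.symm) hl ht0).ne
  · exact hl
  · exact absurd h (ne_of_gt (rk_lt τ q (ht.trans hs.symm) hl hs0))

/-- The policy. -/
noncomputable def pol (T τ L : ℕ) : LAlg 2 2 T :=
  ⟨fun q _ t => if q t = 0 ∧ rk τ q t ≤ L then 0 else 1, by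
    intro q q' v v' t hq _
    simp only
    rw [hq t le_rfl, rk_congr τ t hq]⟩

theorem pol_pt {N τ m : ℕ} (hτ : 0 < τ) (hm : m ≤ τ) {δ : Fin 2 → ℕ} (h0 : δ 0 = 0)
    (h1 : δ 1 = m) (hm' : (0.3 : ℝ) * τ ≤ m) (q : Fin (N * τ) → Fin 2) :
    ((N * τ : ℕ) : ℝ) - ∑ j ∈ Finset.range N, ((m - 0.3 * τ) + (0.01 * τ +
      25 / τ * ((∑ t ∈ ph (N * τ) τ j, zz (q t)) * (∑ t ∈ ph (N * τ) τ j, zz (q t))))) ≤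
      seqReward (N * τ) τ mu11 δ (pl τ δ (pol (N * τ) τ (τ - m)) q) q := by
  set L := τ - m with hL
  set p := pl τ δ (pol (N * τ) τ L) q with hp
  have hpt : ∀ t, p t = if q t = 0 ∧ rk τ q t ≤ L then 0 else 1 := fun t => rfl
  have hav : ∀ t a, availableAt (N * τ) τ δ p t a := by
    intro t a j hj
    by_cases ha : a = 0
    · subst ha; rw [h0]; exact Nat.zero_le _
    · have ha : a = 1 := by revert a; decide
      subst ha
      have hjN : j < N := by
        have h := lt_of_le_of_lt hj t.2
        have := Nat.lt_of_mul_lt_mul_right h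
        omega
      have hadd := pulls_add hτ hjN p
      have hle : ((ph (N * τ) τ j).filter fun t => p t = 0).card ≤ L := by
        have : ((ph (N * τ) τ j).filter fun t => p t = 0).card ≤ (Finset.Icc 1 L).card := by
          have hm : ∀ t ∈ (ph (N * τ) τ j).filter fun t => p t = 0,
              (t : ℕ) / τ = j ∧ q t = 0 ∧ rk τ q t ≤ L := by
            intro t ht
            rw [Finset.mem_filter, mem_ph, hpt] at ht
            refine ⟨ht.1, ?_⟩
            by_contra hn
            rw [if_neg hn] at ht
            exact absurd ht.2 (by decide)
          refine Finset.card_le_card_of_injOn (rk τ q) ?_ ?_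
          · intro t ht
            have := hm t ht
            simp only [Finset.coe_Icc, Set.mem_Icc]
            exact ⟨rk_pos τ q t this.2.1, this.2.2⟩
          · refine (rk_injOn τ j q).mono fun t ht => ?_
            have := hm t ht
            exact ⟨this.1, this.2.1⟩
        simpa using this
      rw [h1]; omega
  have hr : seqReward (N * τ) τ mu11 δ p q =
      ∑ t, (1 - if q t = 0 ∧ L < rk τ q t then (1 : ℝ) else 0) := by
    unfold seqReward
    apply Finset.sum_congr rfl
    intro t _
    rw [if_pos (hav _ _), mu11_eq, hpt]
    by_cases hq : q t = 0
    · by_cases hr : rk τ q t ≤ L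
      · simp [hq, hr, not_lt.2 hr]
      · have hr' := not_le.1 hr
        simp [hq, hr, hr']
    · have hq1 : q t = 1 := by
        generalize q t = u at hq
        revert u; decide
      simp [hq1]
  rw [hr, Finset.sum_sub_distrib, sum_ph hτ (fun t => if q t = 0 ∧ L < rk τ q t then (1 : ℝ) else 0)]
  have hT : ∑ _t : Fin (N * τ), (1 : ℝ) = ((N * τ : ℕ) : ℝ) := by simp
  rw [hT]
  apply sub_le_sub_left
  apply Finset.sum_le_sum
  intro j hj
  rw [Finset.mem_range] at hj
  have hc := card_ph hτ hj
  set Z := ∑ t ∈ ph (N * τ) τ j, zz (q t) with hZ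
  have hτ0 : (0 : ℝ) < τ := Nat.cast_pos.2 hτ
  have hY : ((((ph (N * τ) τ j).filter fun s => q s = 0).card : ℕ) : ℝ) = 0.7 * τ + Z := by
    rw [hZ]
    simp only [zz_eq]
    rw [Finset.sum_sub_distrib, Finset.sum_boole, Finset.sum_const, hc, nsmul_eq_mul]
    ring
  set Y := ((ph (N * τ) τ j).filter fun s => q s = 0).card with hYd
  rw [Finset.sum_boole]
  have hb : ((ph (N * τ) τ j).filter fun t => q t = 0 ∧ L < rk τ q t).card ≤ Y - L := by
    have : ((ph (N * τ) τ j).filter fun t => q t = 0 ∧ L < rk τ q t).card ≤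
        (Finset.Ioc L Y).card := by
      refine Finset.card_le_card_of_injOn (rk τ q) ?_ ?_
      · intro t ht
        have ht' := Finset.mem_filter.1 (Finset.mem_coe.1 ht)
        simp only [Finset.coe_Ioc, Set.mem_Ioc]
        refine ⟨ht'.2.2, ?_⟩
        have := rk_le τ q t
        rw [mem_ph.1 ht'.1] at this
        exact this
      · refine (rk_injOn τ j q).mono fun t ht => ?_
        have ht' := Finset.mem_filter.1 (Finset.mem_coe.1 ht)
        exact ⟨mem_ph.1 ht'.1, ht'.2.1⟩
    simpa using this
  have hsq : Z ≤ 0.01 * τ + 25 / τ * (Z * Z) := by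
    have : 0.01 * τ + 25 / τ * (Z * Z) - Z = (Z - 0.02 * τ) ^ 2 * 25 / τ := by
      field_simp
      ring
    have h2 : 0 ≤ (Z - 0.02 * τ) ^ 2 * 25 / τ := by positivity
    linarith
  have hnn : 0 ≤ 0.01 * (τ : ℝ) + 25 / τ * (Z * Z) := by
    have := mul_self_nonneg Z
    positivity
  have hLr : (L : ℝ) = τ - m := by rw [hL, Nat.cast_sub hm]
  rcases le_total Y L with h | h
  · have : ((ph (N * τ) τ j).filter fun t => q t = 0 ∧ L < rk τ q t).card = 0 := by omega
    rw [this]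
    push_cast
    linarith
  · have hb' : ((((ph (N * τ) τ j).filter fun t => q t = 0 ∧ L < rk τ q t).card : ℕ) : ℝ)
        ≤ Y - L := by
      rw [← Nat.cast_sub h]; exact_mod_cast hb
    linarith

theorem Ex_ZZ {N τ j : ℕ} (hτ : 0 < τ) (hj : j < N) :
    Ex (fun q : Fin (N * τ) → Fin 2 =>
      (∑ t ∈ ph (N * τ) τ j, zz (q t)) * (∑ t ∈ ph (N * τ) τ j, zz (q t))) = 0.21 * τ := by
  simp only [Finset.sum_mul_sum]
  rw [Ex_sum]
  simp only [Ex_sum]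
  have : ∀ s ∈ ph (N * τ) τ j, ∑ t ∈ ph (N * τ) τ j,
      Ex (fun q : Fin (N * τ) → Fin 2 => zz (q s) * zz (q t)) = 0.21 := by
    intro s hs
    rw [Finset.sum_eq_single_of_mem s hs]
    · simp only [zz_sq]
      rw [Ex_add, Ex_const, Ex_smul, Ex_indep s (fun _ => 1) (fun _ _ => rfl)]
      ring
    · intro t _ hts
      exact Ex_indep t (fun q => zz (q s)) (fun q x => by rw [Function.update_of_ne hts.symm])
  rw [Finset.sum_congr rfl this, Finset.sum_const, card_ph hτ hj, nsmul_eq_mul, mul_comm]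

theorem lower {N τ m : ℕ} (hτ : 0 < τ) (hm : m ≤ τ) {δ : Fin 2 → ℕ} (h0 : δ 0 = 0)
    (h1 : δ 1 = m) (hm' : (0.3 : ℝ) * τ ≤ m) {V : Finset ℝ}
    {D : Fin 2 → Fin 2 → ℝ → ℝ} (hD : ValidD mu11 V D) :
    (N : ℝ) * (τ - ((m - 0.3 * τ) + 0.01 * τ + 5.25)) ≤
      optRewardL 2 2 (N * τ) τ P11 mu11 δ D V := by
  refine le_trans ?_ (le_opt τ δ hD (pol (N * τ) τ (τ - m)))
  rw [expRewardL_eq τ δ hD]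
  refine le_trans ?_ (Ex_mono fun q => pol_pt hτ hm h0 h1 hm' q)
  have hτ0 : (0 : ℝ) < τ := Nat.cast_pos.2 hτ
  rw [Ex_sub, Ex_const, Ex_sum]
  have : ∀ j ∈ Finset.range N, Ex (fun q : Fin (N * τ) → Fin 2 =>
      ((m - 0.3 * τ : ℝ) + (0.01 * τ +
      25 / τ * ((∑ t ∈ ph (N * τ) τ j, zz (q t)) * (∑ t ∈ ph (N * τ) τ j, zz (q t))))))
      = (m - 0.3 * τ : ℝ) + (0.01 * τ + 5.25) := by
    intro j hj
    rw [Ex_add, Ex_const, Ex_add, Ex_const, Ex_smul, Ex_ZZ hτ (Finset.mem_range.1 hj)]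
    congr 2
    field_simp
    norm_num
  rw [Finset.sum_congr rfl this, Finset.sum_const, Finset.card_range, nsmul_eq_mul]
  push_cast
  apply le_of_eq
  ring

/-- Proposition 7 of the paper: any single algorithm — in particular any algorithm that is not
given the exposure thresholds as input — suffers linear regret on one of the two instances that
differ only in their thresholds. -/
theorem unknown_thresholds_linear_regret :
    ∃ c : ℝ, 0 < c ∧
    ∃ τ₀ : ℕ, ∀ τ : ℕ, τ₀ ≤ τ →
      ∃ N₀ : ℕ, ∀ N : ℕ, N₀ ≤ N →
        ∀ (V : Finset ℝ) (D : Fin 2 → Fin 2 → ℝ → ℝ), ValidD mu11 V D →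
          ∀ A : LAlg 2 2 (N * τ),
            max
              (optRewardL 2 2 (N * τ) τ P11 mu11 (delta1 τ) D V
                - expRewardL (N * τ) τ P11 mu11 (delta1 τ) D V A)
              (optRewardL 2 2 (N * τ) τ P11 mu11 (delta2 τ) D V
                - expRewardL (N * τ) τ P11 mu11 (delta2 τ) D V A)
              ≥ c * ((N * τ : ℕ) : ℝ) := by
  refine ⟨0.02, by norm_num, 1000, fun τ hτ => ⟨40, fun N hN V D hD A => ?_⟩⟩
  have hτp : 0 < τ := by omega
  have hτr : (1000 : ℝ) ≤ τ := by exact_mod_cast hτ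
  have hNr : (40 : ℝ) ≤ N := by exact_mod_cast hN
  have hm1 : (0.3 : ℝ) * τ ≤ (⌈(0.3 : ℝ) * (τ : ℝ)⌉₊ : ℝ) := Nat.le_ceil _
  have hm2 : (0.4 : ℝ) * τ ≤ (⌈(0.4 : ℝ) * (τ : ℝ)⌉₊ : ℝ) := Nat.le_ceil _
  have hu1 : (⌈(0.3 : ℝ) * (τ : ℝ)⌉₊ : ℝ) < 0.3 * τ + 1 := Nat.ceil_lt_add_one (by positivity)
  have hu2 : (⌈(0.4 : ℝ) * (τ : ℝ)⌉₊ : ℝ) < 0.4 * τ + 1 := Nat.ceil_lt_add_one (by positivity)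
  have hl1 : ⌈(0.3 : ℝ) * (τ : ℝ)⌉₊ ≤ τ := Nat.ceil_le.2 (by linarith)
  have hl2 : ⌈(0.4 : ℝ) * (τ : ℝ)⌉₊ ≤ τ := Nat.ceil_le.2 (by linarith)
  have hle : ⌈(0.3 : ℝ) * (τ : ℝ)⌉₊ ≤ ⌈(0.4 : ℝ) * (τ : ℝ)⌉₊ := Nat.ceil_mono (by linarith)
  have L1 := lower (N := N) hτp hl1 (δ := delta1 τ) rfl rfl hm1 hD
  have L2 := lower (N := N) hτp hl2 (δ := delta2 τ) rfl rfl (by linarith) hD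
  have U := upper hτp (δ₁ := delta1 τ) (δ₂ := delta2 τ) rfl rfl hle hm2 hD A
  have b1 : (N : ℝ) * (0.98 * τ) ≤
      N * (τ - ((⌈(0.3 : ℝ) * (τ : ℝ)⌉₊ - 0.3 * τ) + 0.01 * τ + 5.25)) :=
    mul_le_mul_of_nonneg_left (by linarith) (by linarith)
  have b2 : (N : ℝ) * (0.88 * τ) ≤
      N * (τ - ((⌈(0.4 : ℝ) * (τ : ℝ)⌉₊ - 0.3 * τ) + 0.01 * τ + 5.25)) :=
    mul_le_mul_of_nonneg_left (by linarith) (by linarith)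
  have b3 : 40 * (τ : ℝ) ≤ N * τ := mul_le_mul_of_nonneg_right hNr (by linarith)
  push_cast at U ⊢
  by_contra hcon
  rw [ge_iff_le, not_le, max_lt_iff] at hcon
  obtain ⟨c1, c2⟩ := hcon
  linarith

end ExposureBandits
end
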